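/- arXiv:math/0305105 — 4 statements merged into one kernel-verified Lean document; each statement's English description precedes it below -/
import Mathlib

section
/- Let α be a partial action of a discrete group G on a C*-algebra A. For g ∈ G define τ_g : Â^{D_{g⁻¹}} → Â^{D_g} by τ_g(π)(j) = π(α_g⁻¹(j)) for j ∈ D_g, where Â^J = {π ∈ Â : π(J) ≠ 0}. Then each τ_g is a homeomorphism between open subsets of the spectrum Â, τ_e is the identity, and the collection {τ_g} satisfies τ_{gh} extends τ_g ∘ τ_h; i.e., {τ_g} is a partial action of G on Â by partial homeomorphisms. -/
noncomputable section

/-- A partial action of a discrete group `G` on a (C*-)algebra `A`: a family of closed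
two-sided (star-closed) ideals `D g` together with *-isomorphisms `α g : D g⁻¹ ≃ D g`
satisfying `α g (D g⁻¹ ∩ D h) ⊆ D (g h)`, `α (h g) = α h ∘ α g` on the appropriate domain,
`D 1 = A` and `α 1 = id`. -/
structure PartialAction (G : Type) [Group G] (A : Type) [NonUnitalNormedRing A]
    [StarRing A] [NormedSpace ℂ A] [IsScalarTower ℂ A A] [SMulCommClass ℂ A A]
    [StarModule ℂ A] where
  D : G → NonUnitalStarSubalgebra ℂ A
  closed : ∀ g, IsClosed (D g : Set A)
  idealL : ∀ g, ∀ a : A, ∀ d ∈ D g, a * d ∈ D g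
  idealR : ∀ g, ∀ a : A, ∀ d ∈ D g, d * a ∈ D g
  α : ∀ g : G, ↥(D g⁻¹) ≃⋆ₐ[ℂ] ↥(D g)
  D_one : D (1 : G) = ⊤
  α_one : ∀ d : ↥(D (1 : G)⁻¹), ((α 1 d : A)) = (d : A)
  mapsInto : ∀ g h : G, ∀ d : ↥(D g⁻¹), (d : A) ∈ D h → ((α g d : A)) ∈ D (g * h)
  comp : ∀ h g : G, ∀ d : ↥(D g⁻¹), ∀ hd : (d : A) ∈ D ((h * g)⁻¹),
    ∀ hd2 : ((α g d : A)) ∈ D h⁻¹,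
    ((α (h * g) ⟨(d : A), hd⟩ : A)) = ((α h ⟨(α g d : A), hd2⟩ : A))

/-- A (topologically) irreducible *-representation of `A` on a complex Hilbert space. -/
structure IrrRep (A : Type) [NonUnitalNormedRing A] [StarRing A] [NormedSpace ℂ A]
    [IsScalarTower ℂ A A] [SMulCommClass ℂ A A] [StarModule ℂ A] : Type 1 where
  H : Type
  [nacg : NormedAddCommGroup H]
  [ips : InnerProductSpace ℂ H]
  [cpl : CompleteSpace H]
  ρ : A →⋆ₙₐ[ℂ] (H →L[ℂ] H)
  nonzero : ∃ a v, ρ a v ≠ 0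
  irr : ∀ K : Submodule ℂ H, IsClosed (K : Set H) →
    (∀ a : A, ∀ v ∈ K, ρ a v ∈ K) → K = ⊥ ∨ K = ⊤

variable {A : Type} [NonUnitalNormedRing A] [StarRing A] [NormedSpace ℂ A]
  [IsScalarTower ℂ A A] [SMulCommClass ℂ A A] [StarModule ℂ A]

/-- The kernel of an irreducible representation. -/
def IrrRep.ker (r : IrrRep A) : Set A := {a | r.ρ a = 0}

/-- The set of primitive ideals: kernels of irreducible *-representations. -/
def PrimSet (A : Type) [NonUnitalNormedRing A] [StarRing A] [NormedSpace ℂ A]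
    [IsScalarTower ℂ A A] [SMulCommClass ℂ A A] [StarModule ℂ A] : Set (Set A) :=
  {x | ∃ r : IrrRep A, x = r.ker}

/-- The primitive ideal space `Prim A`. -/
def PrimSpace (A : Type) [NonUnitalNormedRing A] [StarRing A] [NormedSpace ℂ A]
    [IsScalarTower ℂ A A] [SMulCommClass ℂ A A] [StarModule ℂ A] : Type :=
  {x : Set A // x ∈ PrimSet A}

/-- The Jacobson (hull-kernel) topology on `Prim A`: the open sets are generated by the
sets `{x | J ⊄ x}`. -/
instance : TopologicalSpace (PrimSpace A) :=
  TopologicalSpace.generateFrom {U | ∃ J : Set A, U = {x : PrimSpace A | ¬ J ⊆ x.1}}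

/-- `supp J = {x ∈ Prim A : x ⊉ J}`. -/
def suppIdeal (J : Set A) : Set (PrimSpace A) := {x | ¬ J ⊆ x.1}

/-- Unitary equivalence of irreducible representations. -/
def IrrEquiv (r s : IrrRep A) : Prop :=
  letI := r.nacg; letI := r.ips; letI := s.nacg; letI := s.ips
  ∃ U : r.H ≃ₗᵢ[ℂ] s.H, ∀ (a : A) (v : r.H), U (r.ρ a v) = s.ρ a (U v)

instance irrSetoid (A : Type) [NonUnitalNormedRing A] [StarRing A] [NormedSpace ℂ A]
    [IsScalarTower ℂ A A] [SMulCommClass ℂ A A] [StarModule ℂ A] :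
    Setoid (IrrRep A) :=
  ⟨IrrEquiv, by
    constructor
    · intro r
      letI := r.nacg; letI := r.ips
      exact ⟨LinearIsometryEquiv.refl ℂ r.H, fun a v => rfl⟩
    · rintro r s ⟨U, hU⟩
      letI := r.nacg; letI := r.ips; letI := s.nacg; letI := s.ips
      refine ⟨U.symm, fun a v => U.injective ?_⟩
      rw [U.apply_symm_apply, hU, U.apply_symm_apply]
    · rintro r s t ⟨U, hU⟩ ⟨V, hV⟩
      letI := r.nacg; letI := r.ips; letI := s.nacg; letI := s.ips
      letI := t.nacg; letI := t.ips
      exact ⟨U.trans V, fun a v => by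
        simp only [LinearIsometryEquiv.trans_apply, hU, hV]⟩⟩

/-- The spectrum `Â`: unitary equivalence classes of irreducible representations. -/
def SpecSpace (A : Type) [NonUnitalNormedRing A] [StarRing A] [NormedSpace ℂ A]
    [IsScalarTower ℂ A A] [SMulCommClass ℂ A A] [StarModule ℂ A] : Type 1 :=
  Quotient (irrSetoid A)

/-- The kernel, well defined on equivalence classes. -/
def kerQ (p : SpecSpace A) : Set A :=
  Quotient.lift IrrRep.ker (by
    rintro r s ⟨U, hU⟩
    letI := r.nacg; letI := r.ips; letI := r.cpl
    letI := s.nacg; letI := s.ips; letI := s.cpl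
    ext a
    constructor
    · intro (ha : r.ρ a = 0)
      show s.ρ a = 0
      ext v
      have h1 := hU a (U.symm v)
      rw [ha] at h1
      simpa using h1.symm
    · intro (ha : s.ρ a = 0)
      show r.ρ a = 0
      ext v
      have h1 := hU a v
      rw [ha] at h1
      simpa using congrArg U.symm h1) p

/-- The Jacobson topology on `Â`. -/
instance : TopologicalSpace (SpecSpace A) :=
  TopologicalSpace.generateFrom {U | ∃ J : Set A, U = {p : SpecSpace A | ¬ J ⊆ kerQ p}}

/-- `Â^J = {π ∈ Â : π(J) ≠ 0}`. -/
def specSupp (J : Set A) : Set (SpecSpace A) := {p | ¬ J ⊆ kerQ p}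

/-- The relation encoding `τ_g(π)(j) = π(α_g⁻¹(j))`: `TauRel θ g r s` iff `r` is nonzero on
`D_{g⁻¹}`, `s` is nonzero on `D_g`, and there is a unitary `U` with
`s(α_g(d)) = U r(d) U⁻¹` for all `d ∈ D_{g⁻¹}`. -/
def TauRel {G : Type} [Group G] (θ : PartialAction G A) (g : G) (r s : IrrRep A) : Prop :=
  letI := r.nacg; letI := r.ips; letI := s.nacg; letI := s.ips
  (∃ d : A, ∃ _ : d ∈ θ.D g⁻¹, ∃ v, r.ρ d v ≠ 0) ∧
  (∃ d : A, ∃ _ : d ∈ θ.D g, ∃ v, s.ρ d v ≠ 0) ∧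
  ∃ U : r.H ≃ₗᵢ[ℂ] s.H, ∀ (d : ↥(θ.D g⁻¹)) (v : r.H),
    U (r.ρ (d : A) v) = s.ρ ((θ.α g d : A)) (U v)

attribute [instance] IrrRep.nacg IrrRep.ips IrrRep.cpl

/-- The linear map `d ↦ r(d) v` on a subalgebra. -/
def evL (r : IrrRep A) (I : NonUnitalStarSubalgebra ℂ A) (v : r.H) : I →ₗ[ℂ] r.H where
  toFun d := r.ρ (d : A) v
  map_add' x y := by simp
  map_smul' c x := by simp

/-- An irreducible representation not vanishing on an ideal: each nonzero vector is cyclic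
for the ideal. -/
theorem cyc (r : IrrRep A) (I : NonUnitalStarSubalgebra ℂ A)
    (hL : ∀ a : A, ∀ d ∈ I, a * d ∈ I) (hR : ∀ a : A, ∀ d ∈ I, d * a ∈ I)
    (hne : ∃ d ∈ I, ∃ v, r.ρ d v ≠ 0) (v : r.H) (hv : v ≠ 0) :
    DenseRange (evL r I v) := by
  obtain ⟨d0, hd0, w, hw⟩ := hne
  let N : Submodule ℂ r.H :=
    { carrier := {x | ∀ d ∈ I, r.ρ d x = 0}
      add_mem' := by
        intro x y hx hy d hd
        rw [map_add, hx d hd, hy d hd, add_zero]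
      zero_mem' := by intro d hd; exact map_zero _
      smul_mem' := by
        intro c x hx d hd
        rw [map_smul, hx d hd, smul_zero] }
  have hNc : IsClosed (N : Set r.H) := by
    have : (N : Set r.H) = ⋂ d ∈ I, {x | r.ρ d x = 0} := by
      ext x; simp [N]
    rw [this]
    exact isClosed_biInter fun d _ => isClosed_eq (r.ρ d).continuous continuous_const
  have hN : N = ⊥ := by
    rcases r.irr N hNc (by
      intro a x hx d hd
      have := hx (d * a) (hR a d hd)
      rwa [map_mul] at this) with h | h
    · exact h
    · exact absurd ((h ▸ Submodule.mem_top : w ∈ N) d0 hd0) hw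
  have hvN : v ∉ N := by rw [hN]; simpa using hv
  have hvN' : ∃ d ∈ I, r.ρ d v ≠ 0 := by
    by_contra hcon
    push Not at hcon
    exact hvN hcon
  obtain ⟨d1, hd1, hd1v⟩ := hvN'
  let K := (LinearMap.range (evL r I v)).topologicalClosure
  have hmem : ∀ d : I, r.ρ (d : A) v ∈ K := fun d =>
    Submodule.le_topologicalClosure _ ⟨d, rfl⟩
  have hK : K = ⊤ := by
    rcases r.irr K (Submodule.isClosed_topologicalClosure _) (by
      intro a x hx
      refine map_mem_closure (r.ρ a).continuous hx ?_
      rintro _ ⟨d, rfl⟩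
      refine ⟨⟨a * d, hL a d d.2⟩, ?_⟩
      simp [evL]) with h | h
    · have := hmem ⟨d1, hd1⟩
      rw [h] at this
      exact absurd (by simpa using this) hd1v
    · exact h
  have := Submodule.dense_iff_topologicalClosure_eq_top.mpr hK
  exact this

theorem exists_vec (r : IrrRep A) : ∃ v : r.H, v ≠ 0 := by
  obtain ⟨a, v, h⟩ := r.nonzero
  exact ⟨v, fun h0 => h (by rw [h0, map_zero])⟩

/-- Restriction to an ideal stays irreducible. -/
theorem irr_restrict (r : IrrRep A) (I : NonUnitalStarSubalgebra ℂ A)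
    (hL : ∀ a : A, ∀ d ∈ I, a * d ∈ I) (hR : ∀ a : A, ∀ d ∈ I, d * a ∈ I)
    (hne : ∃ d ∈ I, ∃ v, r.ρ d v ≠ 0) (K : Submodule ℂ r.H) (hK : IsClosed (K : Set r.H))
    (hinv : ∀ d ∈ I, ∀ v ∈ K, r.ρ d v ∈ K) : K = ⊥ ∨ K = ⊤ := by
  by_cases h : K = ⊥
  · exact Or.inl h
  right
  obtain ⟨v, hvK, hv⟩ := Submodule.exists_mem_ne_zero_of_ne_bot h
  have hd := cyc r I hL hR hne v hv
  rw [Submodule.eq_top_iff']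
  intro x
  have hx := hd x
  refine closure_minimal ?_ hK hx
  rintro _ ⟨d, rfl⟩
  exact hinv d d.2 v hvK

/-- Key estimate. -/
theorem key_est {B : Type} [NonUnitalCStarAlgebra B] (J : NonUnitalStarSubalgebra ℂ B)
    (hJ : IsClosed (J : Set B)) (hL : ∀ a : B, ∀ d ∈ J, a * d ∈ J)
    {H : Type} [NormedAddCommGroup H] [InnerProductSpace ℂ H] [CompleteSpace H]
    (π : J →⋆ₙₐ[ℂ] (H →L[ℂ] H)) (v : H) (a : B) (d : J) :
    ‖π ⟨a * d, hL a d d.2⟩ v‖ ≤ ‖a‖ * ‖π d v‖ := by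
  haveI : IsClosed (J : Set B) := hJ
  letI : PartialOrder J := CStarAlgebra.spectralOrder J
  haveI : StarOrderedRing J := CStarAlgebra.spectralOrderedRing J
  have hu := CStarAlgebra.increasingApproximateUnit J
  haveI := hu.neBot
  have hcont : Continuous π := by
    refine AddMonoidHomClass.continuous_of_bound π 1 fun x => ?_
    simpa using NonUnitalStarAlgHom.norm_apply_le π x
  have ht : Filter.Tendsto (fun e : J => ‖π ⟨a * ((e * d : J) : B), hL a _ (e * d).2⟩ v‖)
      (CStarAlgebra.approximateUnit J) (nhds ‖π ⟨a * d, hL a d d.2⟩ v‖) := by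
    have h1 : Filter.Tendsto (fun e : J => e * d) (CStarAlgebra.approximateUnit J) (nhds d) :=
      hu.tendsto_mul_right d
    have h2 : Continuous (fun x : J => ‖π ⟨a * (x : B), hL a _ x.2⟩ v‖) := by
      have h3 : Continuous (fun x : J => (⟨a * (x : B), hL a _ x.2⟩ : J)) := by fun_prop
      exact ((hcont.comp h3).clm_apply continuous_const).norm
    exact (h2.tendsto d).comp h1
  refine le_of_tendsto ht ?_
  filter_upwards [hu.eventually_norm] with e he
  have h4 : (⟨a * ((e * d : J) : B), hL a _ (e * d).2⟩ : J) = ⟨a * e, hL a e e.2⟩ * d := by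
    ext; simp [mul_assoc]
  rw [h4, map_mul]
  refine (ContinuousLinearMap.le_opNorm (π ⟨a * e, hL a e e.2⟩) (π d v)).trans ?_
  gcongr
  refine (NonUnitalStarAlgHom.norm_apply_le π _).trans ?_
  calc ‖a * (e : B)‖ ≤ ‖a‖ * ‖(e : B)‖ := norm_mul_le _ _
    _ ≤ ‖a‖ * 1 := by gcongr; exact he
    _ = ‖a‖ := mul_one _

theorem key_est' [CompleteSpace A] [CStarRing A] (J : NonUnitalStarSubalgebra ℂ A)
    (hJ : IsClosed (J : Set A)) (hL : ∀ a : A, ∀ d ∈ J, a * d ∈ J)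
    {H : Type} [NormedAddCommGroup H] [InnerProductSpace ℂ H] [CompleteSpace H]
    (π : J →⋆ₙₐ[ℂ] (H →L[ℂ] H)) (v : H) (a : A) (d : J) :
    ‖π ⟨a * d, hL a d d.2⟩ v‖ ≤ ‖a‖ * ‖π d v‖ := by
  letI : NonUnitalCStarAlgebra A := { }
  exact key_est J hJ hL π v a d

/-- Extension of a cyclic representation from an ideal. -/
theorem extend_rep [CompleteSpace A] [CStarRing A] (J : NonUnitalStarSubalgebra ℂ A)
    (hJ : IsClosed (J : Set A)) (hL : ∀ a : A, ∀ d ∈ J, a * d ∈ J)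
    {H : Type} [NormedAddCommGroup H] [InnerProductSpace ℂ H] [CompleteSpace H]
    (π : J →⋆ₙₐ[ℂ] (H →L[ℂ] H)) (v : H) (hv : DenseRange fun d => π d v) :
    ∃ ρ : A →⋆ₙₐ[ℂ] (H →L[ℂ] H), ∀ d : J, ρ (d : A) = π d := by
  let e : J →ₗ[ℂ] H :=
    { toFun := fun d => π d v
      map_add' := by intro x y; simp
      map_smul' := by intro c x; simp }
  have he : DenseRange e := hv
  let f : A → (J →ₗ[ℂ] H) := fun a =>
    { toFun := fun d => π ⟨a * d, hL a d d.2⟩ v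
      map_add' := by
        intro x y
        have : (⟨a * ((x + y : J) : A), hL a _ (x + y).2⟩ : J)
          = ⟨a * x, hL a x x.2⟩ + ⟨a * y, hL a y y.2⟩ := by ext; simp [mul_add]
        rw [this, map_add, ContinuousLinearMap.add_apply]
      map_smul' := by
        intro c x
        have : (⟨a * ((c • x : J) : A), hL a _ (c • x).2⟩ : J)
          = c • ⟨a * x, hL a x x.2⟩ := by ext; simp [mul_smul_comm]
        rw [this, map_smul, ContinuousLinearMap.smul_apply, RingHom.id_apply] }
  let R : A → (H →L[ℂ] H) := fun a => (f a).extendOfNorm e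
  have hR : ∀ a (d : J), R a (π d v) = π ⟨a * d, hL a d d.2⟩ v := fun a d =>
    LinearMap.extendOfNorm_eq he ⟨‖a‖, fun x => key_est' J hJ hL π v a x⟩ d
  have hext : ∀ S T : H →L[ℂ] H, (∀ d : J, S (π d v) = T (π d v)) → S = T := by
    intro S T h
    apply ContinuousLinearMap.coeFn_injective
    exact hv.equalizer S.continuous T.continuous (funext h)
  refine ⟨{ toFun := R, map_smul' := ?_, map_zero' := ?_, map_add' := ?_, map_mul' := ?_,
            map_star' := ?_ }, ?_⟩
  · intro c a
    apply hext
    intro d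
    have : (⟨(c • a) * d, hL _ d d.2⟩ : J) = c • ⟨a * d, hL a d d.2⟩ := by
      ext; simp [smul_mul_assoc]
    rw [hR, this, map_smul, ContinuousLinearMap.smul_apply, ← hR]
    rfl
  · apply hext
    intro d
    have : (⟨0 * d, hL _ d d.2⟩ : J) = 0 := by ext; simp
    rw [hR, this]
    simp
  · intro a b
    apply hext
    intro d
    have : (⟨(a + b) * d, hL _ d d.2⟩ : J) = ⟨a * d, hL a d d.2⟩ + ⟨b * d, hL b d d.2⟩ := by
      ext; simp [add_mul]
    rw [hR, this, map_add, ContinuousLinearMap.add_apply, ← hR, ← hR]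
    rfl
  · intro a b
    apply hext
    intro d
    rw [hR, mul_apply_eq_comp, hR, hR]
    congr 3
    exact mul_assoc _ _ _
  · intro a
    apply hext
    intro d
    refine ext_inner_right ℂ fun w => ?_
    refine hv.induction_on w ?_ ?_
    · exact isClosed_eq (by fun_prop) (by fun_prop)
    · intro d'
      rw [ContinuousLinearMap.star_eq_adjoint, ContinuousLinearMap.adjoint_inner_left, hR, hR]
      rw [← ContinuousLinearMap.adjoint_inner_right (π ⟨star a * d, _⟩),
        ← ContinuousLinearMap.adjoint_inner_right (π d),
        ← ContinuousLinearMap.star_eq_adjoint, ← ContinuousLinearMap.star_eq_adjoint,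
        ← map_star, ← map_star, ← mul_apply_eq_comp, ← mul_apply_eq_comp,
        ← map_mul, ← map_mul]
      congr 3
      ext
      simp [mul_assoc]
  · intro d
    apply hext
    intro d'
    change R d (π d' v) = _
    rw [hR, ← mul_apply_eq_comp, ← map_mul]
    rfl

/-- The relation: `s ∘ φ` is unitarily equivalent to `r` on `I`. -/
def IRel {I J : NonUnitalStarSubalgebra ℂ A} (φ : I ≃⋆ₐ[ℂ] J) (r s : IrrRep A) : Prop :=
  (∃ d ∈ I, ∃ v, r.ρ d v ≠ 0) ∧ (∃ d ∈ J, ∃ v, s.ρ d v ≠ 0) ∧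
  ∃ U : r.H ≃ₗᵢ[ℂ] s.H, ∀ (d : I) (v : r.H), U (r.ρ (d : A) v) = s.ρ (φ d : A) (U v)

theorem IRel.symm {I J : NonUnitalStarSubalgebra ℂ A} {φ : I ≃⋆ₐ[ℂ] J} {r s : IrrRep A}
    (h : IRel φ r s) : IRel φ.symm s r := by
  obtain ⟨h1, h2, U, hU⟩ := h
  refine ⟨h2, h1, U.symm, fun d v => U.injective ?_⟩
  rw [hU]
  simp

theorem equiv_of_ideal (I : NonUnitalStarSubalgebra ℂ A)
    (hL : ∀ a : A, ∀ d ∈ I, a * d ∈ I) (hR : ∀ a : A, ∀ d ∈ I, d * a ∈ I) (r s : IrrRep A)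
    (hne : ∃ d ∈ I, ∃ v, r.ρ d v ≠ 0) (U : r.H ≃ₗᵢ[ℂ] s.H)
    (hU : ∀ (d : I) (v : r.H), U (r.ρ (d : A) v) = s.ρ (d : A) (U v)) : IrrEquiv r s := by
  refine ⟨U, fun a => ?_⟩
  obtain ⟨v, hv⟩ := exists_vec r
  have hd := cyc r I hL hR hne v hv
  refine congrFun (hd.equalizer (g := fun x => U (r.ρ a x)) (h := fun x => s.ρ a (U x))
    (U.continuous.comp (r.ρ a).continuous) ((s.ρ a).continuous.comp U.continuous) ?_)
  funext d
  change U (r.ρ a (r.ρ (d : A) v)) = s.ρ a (U (r.ρ (d : A) v))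
  rw [hU, ← mul_apply_eq_comp, ← mul_apply_eq_comp, ← map_mul, ← map_mul]
  exact hU ⟨a * d, hL a d d.2⟩ v

theorem IRel.unique {I J : NonUnitalStarSubalgebra ℂ A} {φ : I ≃⋆ₐ[ℂ] J}
    (hL : ∀ a : A, ∀ d ∈ J, a * d ∈ J) (hR : ∀ a : A, ∀ d ∈ J, d * a ∈ J)
    {r s s' : IrrRep A} (h : IRel φ r s) (h' : IRel φ r s') : IrrEquiv s s' := by
  obtain ⟨h1, h2, U, hU⟩ := h
  obtain ⟨-, -, V, hV⟩ := h'
  refine equiv_of_ideal J hL hR s s' h2 (U.symm.trans V) fun d v => ?_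
  have h3 := hU (φ.symm d) (U.symm v)
  have h4 := hV (φ.symm d) (U.symm v)
  simp only [StarAlgEquiv.apply_symm_apply, LinearIsometryEquiv.apply_symm_apply] at h3 h4
  rw [LinearIsometryEquiv.trans_apply, LinearIsometryEquiv.trans_apply, ← h4, ← h3]
  simp

theorem IRel.congr {I J : NonUnitalStarSubalgebra ℂ A} {φ : I ≃⋆ₐ[ℂ] J}
    {r r' s s' : IrrRep A} (h : IRel φ r s) (hr : IrrEquiv r r') (hs : IrrEquiv s s') :
    IRel φ r' s' := by
  obtain ⟨⟨d, hd, v, hv⟩, ⟨d', hd', v', hv'⟩, U, hU⟩ := h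
  obtain ⟨V, hV⟩ := hr
  obtain ⟨W, hW⟩ := hs
  refine ⟨⟨d, hd, V v, ?_⟩, ⟨d', hd', W v', ?_⟩, (V.symm.trans U).trans W, fun x y => ?_⟩
  · rw [← hV]; simpa using hv
  · rw [← hW]; simpa using hv'
  · have h1 := hV x (V.symm y)
    simp only [LinearIsometryEquiv.apply_symm_apply] at h1
    simp only [LinearIsometryEquiv.trans_apply]
    rw [← h1, ← hW, ← hU]
    simp

theorem IRel.exists [CompleteSpace A] [CStarRing A] {I J : NonUnitalStarSubalgebra ℂ A}
    (φ : I ≃⋆ₐ[ℂ] J) (hIL : ∀ a : A, ∀ d ∈ I, a * d ∈ I) (hIR : ∀ a : A, ∀ d ∈ I, d * a ∈ I)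
    (hJ : IsClosed (J : Set A)) (hL : ∀ a : A, ∀ d ∈ J, a * d ∈ J)
    (r : IrrRep A) (hne : ∃ d ∈ I, ∃ v, r.ρ d v ≠ 0) : ∃ s, IRel φ r s := by
  obtain ⟨v, hv⟩ := exists_vec r
  have hd := cyc r I hIL hIR hne v hv
  let π : J →⋆ₙₐ[ℂ] (r.H →L[ℂ] r.H) :=
    { toFun := fun d => r.ρ (φ.symm d : A)
      map_smul' := by intro c x; simp
      map_zero' := by simp
      map_add' := by intro x y; simp
      map_mul' := by intro x y; simp
      map_star' := by intro x; simp [map_star] }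
  have hπ : ∀ d : I, π (φ d) = r.ρ (d : A) := by intro d; simp [π]
  have hdπ : DenseRange fun d => π d v := by
    refine hd.mono ?_
    rintro _ ⟨d, rfl⟩
    exact ⟨φ d, by simp only [hπ]; rfl⟩
  obtain ⟨ρ, hρ⟩ := extend_rep J hJ hL π v hdπ
  have hρ' : ∀ d : I, ρ (φ d : A) = r.ρ (d : A) := fun d => by rw [hρ, hπ]
  obtain ⟨d, hdI, w, hw⟩ := hne
  have hw' : ρ (φ ⟨d, hdI⟩ : A) w ≠ 0 := by rw [hρ']; exact hw
  refine ⟨{ H := r.H, ρ := ρ, nonzero := ⟨_, w, hw'⟩, irr := ?_ }, ⟨d, hdI, w, hw⟩,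
    ⟨_, (φ ⟨d, hdI⟩).2, w, hw'⟩, LinearIsometryEquiv.refl ℂ r.H, ?_⟩
  · intro K hK hinv
    refine irr_restrict r I hIL hIR ⟨d, hdI, w, hw⟩ K hK fun x hx y hy => ?_
    have := hinv (φ ⟨x, hx⟩ : A) y hy
    rwa [hρ'] at this
  · intro x y
    change r.ρ (x : A) y = ρ (φ x : A) y
    rw [hρ']

theorem mem_specSupp (J : Set A) (r : IrrRep A) :
    (⟦r⟧ : SpecSpace A) ∈ specSupp J ↔ ∃ d ∈ J, ∃ v, r.ρ d v ≠ 0 := by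
  change (¬ J ⊆ {a | r.ρ a = 0}) ↔ _
  rw [Set.not_subset]
  refine exists_congr fun d => and_congr_right fun _ => ?_
  change (¬ r.ρ d = 0) ↔ _
  rw [ContinuousLinearMap.ext_iff]
  push Not
  rfl

theorem IRel.supp {I J : NonUnitalStarSubalgebra ℂ A} {φ : I ≃⋆ₐ[ℂ] J}
    (hL : ∀ a : A, ∀ d ∈ J, a * d ∈ J) (hR : ∀ a : A, ∀ d ∈ J, d * a ∈ J)
    {r s : IrrRep A} (h : IRel φ r s) (S : Set A) :
    (⟦s⟧ : SpecSpace A) ∈ specSupp S ↔ (⟦r⟧ : SpecSpace A) ∈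
      specSupp {x | ∃ a ∈ S, ∃ j : J, x = (φ.symm ⟨a * j, hL a j j.2⟩ : A)} := by
  obtain ⟨h1, h2, U, hU⟩ := h
  have hU' : ∀ (j : J) (v : r.H), U (r.ρ (φ.symm j : A) v) = s.ρ (j : A) (U v) := by
    intro j v; rw [hU]; simp
  rw [mem_specSupp, mem_specSupp]
  constructor
  · rintro ⟨a, ha, v, hv⟩
    obtain ⟨w, hw⟩ := exists_vec s
    have hd := cyc s J hL hR h2 w hw
    have : ∃ j : J, s.ρ a (s.ρ (j : A) w) ≠ 0 := by
      by_contra hcon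
      push Not at hcon
      refine hv (congrFun (hd.equalizer (g := fun x => s.ρ a x) (h := fun _ => 0)
        (s.ρ a).continuous continuous_const (funext hcon)) v)
    obtain ⟨j, hj⟩ := this
    refine ⟨_, ⟨a, ha, j, rfl⟩, U.symm w, fun h0 => hj ?_⟩
    have h3 := hU' ⟨a * j, hL a j j.2⟩ (U.symm w)
    rw [h0, map_zero, LinearIsometryEquiv.apply_symm_apply] at h3
    rw [← mul_apply_eq_comp, ← map_mul]
    exact h3.symm
  · rintro ⟨_, ⟨a, ha, j, rfl⟩, v, hv⟩
    refine ⟨a, ha, s.ρ (j : A) (U v), fun h0 => hv (U.injective ?_)⟩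
    rw [hU', map_zero, map_mul]
    exact h0

/-- A closed ideal, packaged. -/
structure IsCIdeal (I : NonUnitalStarSubalgebra ℂ A) : Prop where
  closed : IsClosed (I : Set A)
  left : ∀ a : A, ∀ d ∈ I, a * d ∈ I
  right : ∀ a : A, ∀ d ∈ I, d * a ∈ I

theorem exists_map [CompleteSpace A] [CStarRing A] {I J : NonUnitalStarSubalgebra ℂ A}
    (φ : I ≃⋆ₐ[ℂ] J) (hI : IsCIdeal I) (hJ : IsCIdeal J) :
    ∃ f : specSupp (I : Set A) → specSupp (J : Set A), Continuous f ∧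
      ∀ (x : specSupp (I : Set A)) (r s : IrrRep A), ⟦r⟧ = x.1 → ⟦s⟧ = (f x).1 → IRel φ r s := by
  have h1 : ∀ x : specSupp (I : Set A), ∃ y : specSupp (J : Set A),
      ∀ (r s : IrrRep A), ⟦r⟧ = x.1 → ⟦s⟧ = y.1 → IRel φ r s := by
    rintro ⟨x, hx⟩
    obtain ⟨r, rfl⟩ := Quotient.exists_rep x
    obtain ⟨s, hs⟩ := IRel.exists φ hI.left hI.right hJ.closed hJ.left r
      ((mem_specSupp _ r).1 hx)
    refine ⟨⟨⟦s⟧, (mem_specSupp _ s).2 hs.2.1⟩, fun r' s' hr hs' => ?_⟩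
    exact hs.congr (Quotient.exact hr.symm) (Quotient.exact hs'.symm)
  choose f hf using h1
  refine ⟨f, ?_, hf⟩
  refine Continuous.subtype_mk (f := fun x => (f x).1) ?_ (fun x => (f x).2)
  refine continuous_generateFrom_iff.2 ?_
  rintro _ ⟨S, rfl⟩
  have : (fun x => (f x).1) ⁻¹' {p : SpecSpace A | ¬ S ⊆ kerQ p} = Subtype.val ⁻¹'
      (specSupp {x | ∃ a ∈ S, ∃ j : J, x = (φ.symm ⟨a * j, hJ.left a j j.2⟩ : A)}) := by
    ext x
    obtain ⟨r, hr⟩ := Quotient.exists_rep x.1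
    obtain ⟨s, hs⟩ := Quotient.exists_rep (f x).1
    have := (hf x r s hr hs).supp hJ.left hJ.right S
    rw [hr, hs] at this
    exact this
  rw [this]
  have hopen : IsOpen
      (specSupp {x | ∃ a ∈ S, ∃ j : J, x = (φ.symm ⟨a * j, hJ.left a j j.2⟩ : A)}) :=
    TopologicalSpace.isOpen_generateFrom_of_mem ⟨_, rfl⟩
  exact hopen.preimage continuous_subtype_val

theorem exists_homeo [CompleteSpace A] [CStarRing A] {I J : NonUnitalStarSubalgebra ℂ A}
    (φ : I ≃⋆ₐ[ℂ] J) (hI : IsCIdeal I) (hJ : IsCIdeal J) :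
    ∃ T : specSupp (I : Set A) ≃ₜ specSupp (J : Set A),
      ∀ (x : specSupp (I : Set A)) (r s : IrrRep A), ⟦r⟧ = x.1 → ⟦s⟧ = (T x).1 → IRel φ r s := by
  obtain ⟨f, hfc, hf⟩ := exists_map φ hI hJ
  obtain ⟨k, hkc, hk⟩ := exists_map φ.symm hJ hI
  refine ⟨{ toFun := f, invFun := k, left_inv := ?_, right_inv := ?_,
            continuous_toFun := hfc, continuous_invFun := hkc }, hf⟩
  · intro x
    obtain ⟨r, hr⟩ := Quotient.exists_rep x.1
    obtain ⟨s, hs⟩ := Quotient.exists_rep (f x).1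
    obtain ⟨t, ht⟩ := Quotient.exists_rep (k (f x)).1
    apply Subtype.ext
    rw [← hr, ← ht]
    exact Quotient.sound ((hk _ s t hs ht).unique hI.left hI.right (hf _ r s hr hs).symm)
  · intro x
    obtain ⟨r, hr⟩ := Quotient.exists_rep x.1
    obtain ⟨s, hs⟩ := Quotient.exists_rep (k x).1
    obtain ⟨t, ht⟩ := Quotient.exists_rep (f (k x)).1
    apply Subtype.ext
    rw [← hr, ← ht]
    have h2 := (hk _ r s hr hs).symm
    exact Quotient.sound ((hf _ s t hs ht).unique hJ.left hJ.right h2)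

theorem PartialAction.isCIdeal {G : Type} [Group G] (θ : PartialAction G A) (g : G) :
    IsCIdeal (θ.D g) := ⟨θ.closed g, θ.idealL g, θ.idealR g⟩

theorem tauRel_iff {G : Type} [Group G] (θ : PartialAction G A) (g : G) (r s : IrrRep A) :
    TauRel θ g r s ↔ IRel (θ.α g) r s := by
  simp only [TauRel, IRel, exists_prop]

theorem PartialAction.alpha_eq_one {G : Type} [Group G] (θ : PartialAction G A) (k : G)
    (hk : k = 1) (d : θ.D k⁻¹) : (θ.α k d : A) = d := by
  subst hk
  exact θ.α_one d

theorem PartialAction.mem_one {G : Type} [Group G] (θ : PartialAction G A) (k : G)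
    (hk : k = 1) (a : A) : a ∈ θ.D k := by
  subst hk
  rw [θ.D_one]
  trivial

theorem PartialAction.alpha_symm_mem {G : Type} [Group G] (θ : PartialAction G A) (g h : G)
    (c : θ.D h) (hc : (c : A) ∈ θ.D g⁻¹) :
    (((θ.α h).symm c : θ.D h⁻¹) : A) ∈ θ.D (g * h)⁻¹ := by
  have hc' : (c : A) ∈ θ.D h⁻¹⁻¹ := by rw [inv_inv]; exact c.2
  have h1 := θ.mapsInto h⁻¹ g⁻¹ ⟨c, hc'⟩ hc
  have h2 := θ.comp h⁻¹ h ((θ.α h).symm c) (θ.mem_one _ (by simp) _)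
    (by rw [StarAlgEquiv.apply_symm_apply]; exact hc')
  rw [θ.alpha_eq_one _ (by simp)] at h2
  simp only [StarAlgEquiv.apply_symm_apply] at h2
  rw [mul_inv_rev, h2]
  exact h1

theorem tau_comp {G : Type} [Group G] (θ : PartialAction G A) (g h : G) (r s t : IrrRep A)
    (h1 : TauRel θ h r s) (h2 : TauRel θ g s t) : TauRel θ (g * h) r t := by
  rw [tauRel_iff] at *
  obtain ⟨-, ⟨c, hc, w, hw⟩, U, hU⟩ := h1
  obtain ⟨hs, -, V, hV⟩ := h2
  have hd := cyc s _ (θ.idealL g⁻¹) (θ.idealR g⁻¹) hs w (fun h0 => hw (by rw [h0, map_zero]))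
  have h3 : ∃ j : θ.D g⁻¹, s.ρ c (s.ρ (j : A) w) ≠ 0 := by
    by_contra hcon
    push Not at hcon
    refine hw (congrFun (hd.equalizer (g := fun x => s.ρ c x) (h := fun _ => 0)
      (s.ρ c).continuous continuous_const (funext hcon)) w)
  obtain ⟨j, hj⟩ := h3
  have hcj : c * (j : A) ∈ θ.D h := θ.idealR h _ _ hc
  have hcj' : c * (j : A) ∈ θ.D g⁻¹ := θ.idealL g⁻¹ _ _ j.2
  let I : NonUnitalStarSubalgebra ℂ A := θ.D h⁻¹ ⊓ θ.D (g * h)⁻¹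
  have hIL : ∀ a : A, ∀ d ∈ I, a * d ∈ I := fun a d hd =>
    ⟨θ.idealL _ a d hd.1, θ.idealL _ a d hd.2⟩
  have hIR : ∀ a : A, ∀ d ∈ I, d * a ∈ I := fun a d hd =>
    ⟨θ.idealR _ a d hd.1, θ.idealR _ a d hd.2⟩
  let i : θ.D h⁻¹ := (θ.α h).symm ⟨c * (j : A), hcj⟩
  have hi : (i : A) ∈ I := ⟨i.2, θ.alpha_symm_mem g h ⟨c * (j : A), hcj⟩ hcj'⟩
  have hri : r.ρ (i : A) (U.symm w) ≠ 0 := by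
    intro h0
    have h4 := hU i (U.symm w)
    rw [h0, map_zero, LinearIsometryEquiv.apply_symm_apply] at h4
    simp only [i, StarAlgEquiv.apply_symm_apply] at h4
    rw [map_mul] at h4
    exact hj h4.symm
  have key : ∀ (d : A) (hd : d ∈ I) (v : r.H),
      V (U (r.ρ d v)) = t.ρ (θ.α (g * h) ⟨d, hd.2⟩ : A) (V (U v)) := by
    intro d hd v
    have hm : (θ.α h ⟨d, hd.1⟩ : A) ∈ θ.D g⁻¹ := by
      have := θ.mapsInto h (g * h)⁻¹ ⟨d, hd.1⟩ hd.2
      simpa using this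
    have h5 := θ.comp g h ⟨d, hd.1⟩ hd.2 hm
    rw [h5, ← hV, ← hU]
  refine ⟨⟨i, hi.2, _, hri⟩, ⟨_, (θ.α (g * h) ⟨i, hi.2⟩).2, V (U (U.symm w)), ?_⟩,
    U.trans V, fun d => ?_⟩
  · rw [← key i hi]
    simpa using hri
  · have hd2 := cyc r I hIL hIR ⟨i, hi, _, hri⟩ (U.symm w)
      (fun h0 => hri (by rw [h0, map_zero]))
    refine congrFun (hd2.equalizer (g := fun x => V (U (r.ρ (d : A) x)))
      (h := fun x => t.ρ (θ.α (g * h) d : A) (V (U x)))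
      (V.continuous.comp (U.continuous.comp (r.ρ (d : A)).continuous))
      ((t.ρ _).continuous.comp (V.continuous.comp U.continuous)) ?_)
    funext x
    change V (U (r.ρ (d : A) (r.ρ (x : A) (U.symm w)))) =
      t.ρ (θ.α (g * h) d : A) (V (U (r.ρ (x : A) (U.symm w))))
    rw [key x x.2, ← mul_apply_eq_comp, ← mul_apply_eq_comp,
      ← map_mul, ← map_mul, key _ (hIL d x x.2)]
    congr 2
    have h6 : (⟨(d : A) * x, (hIL d x x.2).2⟩ : θ.D (g * h)⁻¹) = d * ⟨x, x.2.2⟩ := rfl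
    rw [h6, map_mul]
    rfl

/-- each `τ_g` is a homeomorphism between the open subsets `Â^{D_{g⁻¹}}` and
`Â^{D_g}` of the spectrum, `τ_e = id`, and `τ_{gh}` extends `τ_g ∘ τ_h`; i.e. `{τ_g}` is a
partial action of `G` on `Â` by partial homeomorphisms. -/
theorem tauRel_partialAction_on_spectrum
    {G : Type} [Group G] {A : Type} [NonUnitalCStarAlgebra A] [NormedSpace ℂ A]
    [IsScalarTower ℂ A A] [SMulCommClass ℂ A A] [StarModule ℂ A]
    (θ : PartialAction G A) :
    (∀ g : G, IsOpen (specSupp (θ.D g : Set A))) ∧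
    (∀ g : G, ∃ T : ↥(specSupp (θ.D g⁻¹ : Set A)) ≃ₜ ↥(specSupp (θ.D g : Set A)),
      ∀ (x : ↥(specSupp (θ.D g⁻¹ : Set A))) (r s : IrrRep A),
        ⟦r⟧ = x.1 → ⟦s⟧ = (T x).1 → TauRel θ g r s) ∧
    (∀ r : IrrRep A, TauRel θ 1 r r) ∧
    (∀ (g h : G) (r s t : IrrRep A), TauRel θ h r s → TauRel θ g s t →
      TauRel θ (g * h) r t) := by
  refine ⟨fun g => TopologicalSpace.isOpen_generateFrom_of_mem ⟨_, rfl⟩, fun g => ?_,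
    fun r => ?_, tau_comp θ⟩
  · obtain ⟨T, hT⟩ := exists_homeo (θ.α g) (θ.isCIdeal g⁻¹) (θ.isCIdeal g)
    exact ⟨T, fun x r s hr hs => (tauRel_iff θ g r s).2 (hT x r s hr hs)⟩
  · rw [tauRel_iff]
    obtain ⟨a, v, hv⟩ := r.nonzero
    refine ⟨⟨a, θ.mem_one _ inv_one a, v, hv⟩, ⟨a, θ.mem_one _ rfl a, v, hv⟩,
      LinearIsometryEquiv.refl ℂ r.H, fun d w => ?_⟩
    rw [θ.α_one]
    simp
end
end

section
/- Let A be a C*-algebra. For d ∈ A define the function d̆ on Prim A by d̆(x) = inf_{j∈x} ‖d + j‖ (the norm of the image of d in A/x). Then d̆ is lower semicontinuous on Prim A with the Jacobson topology, and sup_{x ∈ Prim A} d̆(x) = ‖d‖, with the supremum attained at some point of Prim A. -/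
noncomputable section

variable {A : Type} [NonUnitalNormedRing A] [StarRing A] [NormedSpace ℂ A]
  [IsScalarTower ℂ A A] [SMulCommClass ℂ A A] [StarModule ℂ A]

/-- The function `d̆` on `Prim A`: `d̆(x) = inf_{j ∈ x} ‖d + j‖`, the norm of the image of
`d` in `A/x`. -/
def breve {A : Type} [NonUnitalNormedRing A] [StarRing A] [NormedSpace ℂ A]
    [IsScalarTower ℂ A A] [SMulCommClass ℂ A A] [StarModule ℂ A]
    (d : A) (x : PrimSpace A) : ℝ :=
  sInf {r : ℝ | ∃ j ∈ x.1, r = ‖d + j‖}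

theorem aux_map_norm {A B : Type*} [NonUnitalCStarAlgebra A] [NonUnitalCStarAlgebra B]
    (φ : A →⋆ₙₐ[ℂ] B) (a : A) : ‖φ a‖ ≤ ‖a‖ := NonUnitalStarAlgHom.norm_apply_le φ a

theorem aux_map_cfc {A B : Type*} [NonUnitalCStarAlgebra A] [NonUnitalCStarAlgebra B]
    (φ : A →⋆ₙₐ[ℂ] B) (f : ℝ → ℝ) (hf : Continuous f) (hf0 : f 0 = 0) (a : A) (ha : IsSelfAdjoint a) :
    φ (cfcₙ f a) = cfcₙ f (φ a) :=
  NonUnitalStarAlgHomClass.map_cfcₙ (S := ℂ) φ f a (hf.continuousOn) hf0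
     (AddMonoidHomClass.continuous_of_bound φ 1 fun x => by
       rw [one_mul]; exact aux_map_norm φ x) ha (ha.map φ)

theorem aux_spec {B : Type*} [NonUnitalCStarAlgebra B] (d : B) (t : ℝ)
    (ht : t ∈ quasispectrum ℝ (star d * d)) : 0 ≤ t ∧ t ≤ ‖d‖ ^ 2 := by
  let _ := CStarAlgebra.spectralOrder B
  have := CStarAlgebra.spectralOrderedRing B
  constructor
  · exact quasispectrum_nonneg_of_nonneg _ (star_mul_self_nonneg d) t ht
  · have := NonUnitalIsometricContinuousFunctionalCalculus.norm_quasispectrum_le (star d * d) ht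
      (IsSelfAdjoint.star_mul_self d)
    rw [CStarRing.norm_star_mul_self] at this
    calc t ≤ ‖t‖ := le_abs_self t
      _ ≤ _ := by rw [pow_two]; exact this

theorem aux_lift {A B : Type*} [NonUnitalCStarAlgebra A] [NonUnitalCStarAlgebra B]
    (φ : A →⋆ₙₐ[ℂ] B) (d : A) (c : ℝ) (hc : 0 < c) (h : ‖φ d‖ ≤ c) :
    ∃ j, φ j = 0 ∧ ‖d + j‖ ≤ c := by
  set a := star d * d with ha
  have hsa : IsSelfAdjoint a := IsSelfAdjoint.star_mul_self d
  let g : ℝ → ℝ := fun t => 1 - c / √(max t (c ^ 2))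
  have hpos : ∀ t, 0 < √(max t (c ^ 2)) := fun t =>
    Real.sqrt_pos.2 (lt_of_lt_of_le (by positivity) (le_max_right _ _))
  have hg : Continuous g := by
    refine continuous_const.sub (continuous_const.div (by fun_prop) fun t => (hpos t).ne')
  have hg0 : ∀ t ≤ c ^ 2, g t = 0 := by
    intro t ht
    simp only [g]
    rw [max_eq_right ht, Real.sqrt_sq hc.le, div_self hc.ne', sub_self]
  have hgz : g 0 = 0 := hg0 0 (by positivity)
  set e := cfcₙ g a with he
  have hesa : star e = e := (cfcₙ_predicate g a : IsSelfAdjoint e)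
  refine ⟨-(d * e), ?_, ?_⟩
  · rw [map_neg, map_mul, he, aux_map_cfc φ g hg hgz a hsa]
    have : cfcₙ g (φ a) = cfcₙ (fun _ => (0:ℝ)) (φ a) := by
      apply cfcₙ_congr
      intro t ht
      rw [ha, map_mul, map_star] at ht
      have := aux_spec _ t ht
      exact hg0 t (this.2.trans (by gcongr))
    rw [this, cfcₙ_const_zero, mul_zero, neg_zero]
  · have h1 : star (d + -(d * e)) * (d + -(d * e)) = a - e * a - a * e + e * a * e := by
      simp only [star_add, star_neg, star_mul, hesa, ha]
      noncomm_ring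
    have h2 : a - e * a - a * e + e * a * e =
        cfcₙ (fun t => t - g t * t - t * g t + g t * t * g t) a := by
      rw [cfcₙ_add (fun t => t - g t * t - t * g t) (fun t => g t * t * g t) a (by fun_prop) (by simp) (by fun_prop) (by simp),
        cfcₙ_sub (fun t => t - g t * t) (fun t => t * g t) a (by fun_prop) (by simp) (by fun_prop) (by simp),
        cfcₙ_sub (fun t => t) (fun t => g t * t) a (by fun_prop) (by simp) (by fun_prop) (by simp),
        cfcₙ_mul (fun t => g t * t) g a (by fun_prop) (by simp) (by fun_prop) hgz,
        cfcₙ_mul g (fun t => t) a (by fun_prop) hgz (by fun_prop) (by simp),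
        cfcₙ_mul (fun t => t) g a (by fun_prop) (by simp) (by fun_prop) hgz,
        cfcₙ_id' ℝ a]
    have h3 : ‖d + -(d * e)‖ * ‖d + -(d * e)‖ ≤ c * c := by
      rw [← CStarRing.norm_star_mul_self, h1, h2]
      apply norm_cfcₙ_le
      intro t ht
      have h0 := (aux_spec d t ht).1
      have e1 : t - g t * t - t * g t + g t * t * g t = t * (c ^ 2 / max t (c ^ 2)) := by
        have : (1 - g t) ^ 2 = c ^ 2 / max t (c ^ 2) := by
          simp only [g]
          rw [sub_sub_cancel, div_pow, Real.sq_sqrt (h0.trans (le_max_left _ _))]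
        rw [← this]; ring
      have hm : 0 < max t (c ^ 2) := lt_of_lt_of_le (by positivity) (le_max_right _ _)
      rw [e1, Real.norm_eq_abs, abs_of_nonneg (by positivity), ← mul_div_assoc, div_le_iff₀ hm]
      nlinarith [le_max_left t (c ^ 2), mul_pos hc hc]
    nlinarith [norm_nonneg (d + -(d * e))]

theorem aux_thresh {A B : Type*} [NonUnitalCStarAlgebra A] [NonUnitalCStarAlgebra B]
    (φ : A →⋆ₙₐ[ℂ] B) (d : A) (α : ℝ) (hα : 0 ≤ α) :
    φ (cfcₙ (fun t : ℝ => max (t - α ^ 2) 0) (star d * d)) = 0 ↔ ‖φ d‖ ≤ α := by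
  have h0 : max ((0:ℝ) - α ^ 2) 0 = 0 := max_eq_right (by nlinarith)
  rw [aux_map_cfc φ (fun t : ℝ => max (t - α ^ 2) 0) (by fun_prop) h0 _ (IsSelfAdjoint.star_mul_self d), map_mul, map_star]
  set b := φ d
  constructor
  · intro h
    have hb : ‖star b * b‖ ≤ α ^ 2 := by
      conv_lhs => rw [← cfcₙ_id' ℝ (star b * b) (IsSelfAdjoint.star_mul_self b)]
      apply norm_cfcₙ_le
      intro t ht
      have h1 := norm_apply_le_norm_cfcₙ (fun t : ℝ => max (t - α ^ 2) 0) (star b * b) ht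
        (by fun_prop) h0 (IsSelfAdjoint.star_mul_self b)
      rw [h, norm_zero] at h1
      have h2 := norm_le_zero_iff.1 h1
      have h3 : t - α ^ 2 ≤ 0 := (le_max_left _ _).trans h2.le
      rw [Real.norm_eq_abs, abs_of_nonneg (aux_spec b t ht).1]; linarith
    rw [CStarRing.norm_star_mul_self] at hb
    nlinarith [norm_nonneg b]
  · intro h
    rw [cfcₙ_congr (g := fun _ => (0:ℝ)), cfcₙ_const_zero]
    intro t ht
    have := (aux_spec b t ht).2
    refine max_eq_right ?_
    nlinarith [norm_nonneg b]

theorem aux_irred {B H : Type*} [CStarAlgebra B] [NormedAddCommGroup H] [InnerProductSpace ℂ H]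
    [CompleteSpace H] (ρ : B →⋆ₐ[ℂ] (H →L[ℂ] H)) (ξ : H) (hξ : ‖ξ‖ = 1)
    (hd : DenseRange fun x => ρ x ξ) (φ : StrongDual ℂ B) (hφ : ∀ x, φ x = inner ℂ ξ (ρ x ξ))
    (hpure : ∀ ψ₁ ψ₂ : StrongDual ℂ B, ‖ψ₁‖ ≤ 1 → ‖ψ₂‖ ≤ 1 → ∀ t : ℝ, 0 < t → t < 1 →
      (∀ x, φ x = t * ψ₁ x + (1 - t : ℝ) * ψ₂ x) → ψ₁ = φ)
    (K : Submodule ℂ H) (hK : IsClosed (K : Set H)) (hinv : ∀ x, ∀ v ∈ K, ρ x v ∈ K) :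
    K = ⊥ ∨ K = ⊤ := by
  have htop : ∀ L : Submodule ℂ H, IsClosed (L : Set H) → (∀ x, ρ x ξ ∈ L) → L = ⊤ := by
    intro L hL h
    rw [eq_top_iff]
    intro v _
    have := hd v
    exact (closure_minimal (by rintro _ ⟨x, rfl⟩; exact h x) hL) this
  have : CompleteSpace K := hK.completeSpace_coe
  have hadj : ∀ x v w, inner ℂ v (ρ x w) = inner ℂ (ρ (star x) v) w := by
    intro x v w
    rw [map_star, ContinuousLinearMap.star_eq_adjoint, ContinuousLinearMap.adjoint_inner_left]
  have hinv' : ∀ x, ∀ v ∈ Kᗮ, ρ x v ∈ Kᗮ := by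
    intro x v hv
    rw [Submodule.mem_orthogonal] at hv ⊢
    intro u hu
    rw [hadj]; exact hv _ (hinv _ u hu)
  have hψ : ∀ v : H, v ≠ 0 → ∃ ψ : StrongDual ℂ B, ‖ψ‖ ≤ 1 ∧
      ∀ x, ψ x = ((‖v‖ ^ 2 : ℝ) : ℂ)⁻¹ * inner ℂ v (ρ x v) := by
    intro v hv
    have hv' : 0 < ‖v‖ := norm_pos_iff.2 hv
    let l : B →ₗ[ℂ] ℂ :=
      { toFun := fun x => ((‖v‖ ^ 2 : ℝ) : ℂ)⁻¹ * inner ℂ v (ρ x v)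
        map_add' := by intro x y; simp [mul_add]
        map_smul' := by intro c x; simp; ring }
    refine ⟨l.mkContinuous 1 ?_, LinearMap.mkContinuous_norm_le _ zero_le_one _, fun x => rfl⟩
    intro x
    show ‖((‖v‖ ^ 2 : ℝ) : ℂ)⁻¹ * inner ℂ v (ρ x v)‖ ≤ 1 * ‖x‖
    rw [norm_mul, norm_inv, Complex.norm_real, Real.norm_eq_abs, abs_of_pos (by positivity),
      one_mul, inv_mul_le_iff₀ (by positivity)]
    calc ‖inner ℂ v (ρ x v)‖ ≤ ‖v‖ * ‖ρ x v‖ := norm_inner_le_norm _ _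
      _ ≤ ‖v‖ * (‖ρ x‖ * ‖v‖) := by gcongr; exact (ρ x).le_opNorm v
      _ ≤ ‖v‖ * (‖x‖ * ‖v‖) := by gcongr; exact NonUnitalStarAlgHom.norm_apply_le ρ x
      _ = _ := by ring
  obtain ⟨p, hp, q, hq, hpq⟩ := K.exists_add_mem_mem_orthogonal ξ
  have hpq0 : ∀ u ∈ K, ∀ w ∈ Kᗮ, inner ℂ u w = 0 := fun u hu w hw => hw u hu
  have hqp0 : ∀ u ∈ K, ∀ w ∈ Kᗮ, inner ℂ w u = 0 := fun u hu w hw =>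
    (Submodule.mem_orthogonal' K w).1 hw u hu
  by_cases hq0 : q = 0
  · right
    apply htop K hK
    intro x
    apply hinv
    rw [hpq, hq0, add_zero]; exact hp
  by_cases hp0 : p = 0
  · left
    have : Kᗮ = ⊤ := by
      apply htop _ K.isClosed_orthogonal
      intro x
      apply hinv'
      rw [hpq, hp0, zero_add]; exact hq
    exact (Submodule.orthogonal_eq_top_iff K).1 this
  exfalso
  obtain ⟨ψ₁, hn1, h1⟩ := hψ p hp0
  obtain ⟨ψ₂, hn2, h2⟩ := hψ q hq0
  have hnorm : ‖p‖ ^ 2 + ‖q‖ ^ 2 = 1 := by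
    have := norm_add_sq_eq_norm_sq_add_norm_sq_of_inner_eq_zero (𝕜 := ℂ) p q (hpq0 p hp q hq)
    rw [← hpq, hξ] at this
    nlinarith
  have hpp : 0 < ‖p‖ := norm_pos_iff.2 hp0
  have hqq : 0 < ‖q‖ := norm_pos_iff.2 hq0
  have hcp : ((‖p‖ ^ 2 : ℝ) : ℂ) ≠ 0 := by exact_mod_cast (by positivity : ‖p‖ ^ 2 ≠ 0)
  have hcq : ((‖q‖ ^ 2 : ℝ) : ℂ) ≠ 0 := by exact_mod_cast (by positivity : ‖q‖ ^ 2 ≠ 0)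
  have key := hpure ψ₁ ψ₂ hn1 hn2 (‖p‖ ^ 2) (by positivity) (by nlinarith) (by
    intro x
    have e : 1 - ‖p‖ ^ 2 = ‖q‖ ^ 2 := by linarith
    rw [e, h1, h2, mul_inv_cancel_left₀ hcp, mul_inv_cancel_left₀ hcq, hφ, hpq, map_add,
      inner_add_left, inner_add_right, inner_add_right, hpq0 p hp _ (hinv' x q hq),
      hqp0 _ (hinv x p hp) q hq]
    ring)
  have hz : ∀ v : H, inner ℂ (p - ((‖p‖ ^ 2 : ℝ) : ℂ) • ξ) v = 0 := by
    intro v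
    refine hd.induction_on (p := fun v => inner ℂ (p - ((‖p‖ ^ 2 : ℝ) : ℂ) • ξ) v = 0) v
      (isClosed_eq (by fun_prop) continuous_const) ?_
    intro x
    have e1 := h1 x
    rw [key, hφ] at e1
    have e2 : inner ℂ p (ρ x ξ) = inner ℂ p (ρ x p) := by
      rw [hpq, map_add, inner_add_right, hpq0 p hp _ (hinv' x q hq), add_zero]
    rw [inner_sub_left, inner_smul_left, e1, e2, Complex.conj_ofReal, mul_inv_cancel_left₀ hcp,
      sub_self]
  have hz' := hz q
  rw [inner_sub_left, hpq0 p hp q hq, inner_smul_left, hpq, inner_add_left, hpq0 p hp q hq,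
    zero_sub, neg_eq_zero, zero_add, Complex.conj_ofReal] at hz'
  rcases mul_eq_zero.1 hz' with h | h
  · exact hcp h
  · exact hq0 (inner_self_eq_zero.1 h)

theorem aux_pos {B : Type*} [CStarAlgebra B] [PartialOrder B] [StarOrderedRing B]
    (φ : StrongDual ℂ B) (hn : ‖φ‖ ≤ 1) (h1 : φ 1 = 1) (x : B) (hx : 0 ≤ x) :
    0 ≤ (φ x).re ∧ (φ x).im = 0 := by
  have hle : ∀ y, ‖φ y‖ ≤ ‖y‖ := fun y => by
    simpa using φ.le_of_opNorm_le hn y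
  have hN : ‖(1 : B)‖ ≤ 1 := by
    rcases subsingleton_or_nontrivial B with h | h
    · rw [Subsingleton.elim (1 : B) 0]; simp
    · rw [CStarRing.norm_one]
  have hxsa : star x = x := (IsSelfAdjoint.of_nonneg hx)
  constructor
  · have h2 : ‖(‖x‖ : ℂ) • (1 : B) - x‖ ≤ ‖x‖ := by
      have e1 : x ≤ (‖x‖ : ℂ) • (1 : B) := by
        have := IsSelfAdjoint.le_algebraMap_norm_self (IsSelfAdjoint.of_nonneg hx)
        rwa [Algebra.algebraMap_eq_smul_one, ← Complex.coe_smul] at this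
      refine (CStarAlgebra.norm_le_norm_of_nonneg_of_le (sub_nonneg.2 e1)
        (sub_le_self _ hx)).trans ?_
      rw [norm_smul, Complex.norm_real, norm_norm]
      exact mul_le_of_le_one_right (norm_nonneg _) hN
    have h3 := (hle _).trans h2
    rw [map_sub, map_smul, h1, smul_eq_mul, mul_one] at h3
    have h4 := (Complex.re_le_norm _).trans h3
    simp at h4
    exact h4
  · have key : ∀ s : ℝ, ((φ x).im + s) ^ 2 ≤ ‖x‖ ^ 2 + s ^ 2 := by
      intro s
      have e1 : φ (x + ((s : ℂ) * Complex.I) • (1 : B)) = φ x + s * Complex.I := by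
        rw [map_add, map_smul, h1, smul_eq_mul, mul_one]
      have e2 := (Complex.abs_im_le_norm _).trans (e1 ▸ hle (x + ((s : ℂ) * Complex.I) • (1 : B)))
      have e3 : ‖x + ((s : ℂ) * Complex.I) • (1 : B)‖ ^ 2 ≤ ‖x‖ ^ 2 + s ^ 2 := by
        rw [pow_two, ← CStarRing.norm_star_mul_self]
        have : star (x + ((s : ℂ) * Complex.I) • (1 : B)) * (x + ((s : ℂ) * Complex.I) • (1 : B))
            = x * x + ((s ^ 2 : ℝ) : ℂ) • (1 : B) := by
          simp only [star_add, star_smul, star_one, hxsa, add_mul, mul_add, smul_mul_assoc,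
            mul_smul_comm, one_mul, mul_one]
          have h5 : star ((s : ℂ) * Complex.I) = -((s : ℂ) * Complex.I) := by simp
          have h6 : (s : ℂ) * Complex.I * ((s : ℂ) * Complex.I) = -((s ^ 2 : ℝ) : ℂ) := by
            push_cast; linear_combination ((s:ℂ)^2) * Complex.I_mul_I
          rw [h5]
          simp only [neg_smul, smul_neg, smul_add, smul_smul, h6]
          abel
        rw [this]
        refine (norm_add_le _ _).trans ?_
        rw [norm_smul, Complex.norm_real, Real.norm_eq_abs, abs_of_nonneg (sq_nonneg s)]
        refine add_le_add ((norm_mul_le _ _).trans (by rw [pow_two])) ?_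
        exact mul_le_of_le_one_right (sq_nonneg s) hN
      have e4 : (φ x + s * Complex.I).im = (φ x).im + s := by simp
      rw [e4] at e2
      calc _ = |(φ x).im + s| ^ 2 := (sq_abs _).symm
        _ ≤ _ := by gcongr
        _ ≤ _ := e3
    by_contra hb
    have := key ((‖x‖ ^ 2 + 1) / (2 * (φ x).im))
    have h8 : 2 * (φ x).im * ((‖x‖ ^ 2 + 1) / (2 * (φ x).im)) = ‖x‖ ^ 2 + 1 := by
      field_simp
    nlinarith [sq_nonneg (φ x).im]

theorem aux_norm_one_add {B : Type*} [CStarAlgebra B] [PartialOrder B] [StarOrderedRing B]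
    [Nontrivial B] (a : B) (ha : 0 ≤ a) : ‖1 + a‖ = 1 + ‖a‖ := by
  apply le_antisymm
  · exact (norm_add_le _ _).trans (by rw [CStarRing.norm_one])
  · have hs : IsSelfAdjoint a := IsSelfAdjoint.of_nonneg ha
    have h := norm_apply_le_norm_cfc (fun t : ℝ => 1 + t) a
      (CStarAlgebra.norm_mem_spectrum_of_nonneg ha) (by fun_prop) hs
    rw [cfc_const_add 1 (fun t : ℝ => t) a (by fun_prop) hs, cfc_id' ℝ a hs, map_one] at h
    exact (le_abs_self _).trans h

theorem aux_pure {B : Type*} [CStarAlgebra B] [PartialOrder B] [StarOrderedRing B]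
    [Nontrivial B] (a : B) (ha : 0 ≤ a) : ∃ φ : StrongDual ℂ B, ‖φ‖ ≤ 1 ∧ φ 1 = 1 ∧ φ a = ‖a‖ ∧
    ∀ ψ₁ ψ₂ : StrongDual ℂ B, ‖ψ₁‖ ≤ 1 → ‖ψ₂‖ ≤ 1 → ∀ t : ℝ, 0 < t → t < 1 →
      (∀ x, φ x = t * ψ₁ x + (1 - t : ℝ) * ψ₂ x) → ψ₁ = φ := by
  have hle : ∀ φ : StrongDual ℂ B, ‖φ‖ ≤ 1 → ∀ y, ‖φ y‖ ≤ ‖y‖ := fun φ hn y => by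
    simpa using φ.le_of_opNorm_le hn y
  -- real part maximal forces equality
  have hmax : ∀ (z : ℂ) (r : ℝ), ‖z‖ ≤ r → r ≤ z.re → z = r := by
    intro z r h1 h2
    have h3 := Complex.re_le_norm z
    have hr : z.re = r := by linarith
    apply Complex.ext
    · simpa using hr
    · have h4 := Complex.sq_norm z
      rw [Complex.normSq_apply] at h4
      have h5 : ‖z‖ = r := by linarith
      rw [h5, hr] at h4
      have : z.im * z.im = 0 := by nlinarith
      simpa using this
  let S : Set (WeakDual ℂ B) := (WeakDual.toStrongDual ⁻¹' Metric.closedBall 0 1) ∩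
    {φ | φ (1 + a) = ((1 + ‖a‖ : ℝ) : ℂ)}
  have hScomp : IsCompact S := by
    refine (WeakDual.isCompact_closedBall (0 : StrongDual ℂ B) 1).inter_right ?_
    exact isClosed_eq (WeakDual.eval_continuous _) continuous_const
  let T : Set (B → ℂ) := (fun (φ : WeakDual ℂ B) (x : B) => φ x) '' S
  have hTcomp : IsCompact T := hScomp.image (continuous_pi fun x => WeakDual.eval_continuous x)
  have hTmem : ∀ f : B → ℂ, f ∈ T ↔ ∃ φ : StrongDual ℂ B, ‖φ‖ ≤ 1 ∧
      φ (1 + a) = ((1 + ‖a‖ : ℝ) : ℂ) ∧ (fun x => φ x) = f := by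
    intro f
    constructor
    · rintro ⟨φ, ⟨h1, h2⟩, rfl⟩
      exact ⟨WeakDual.toStrongDual φ, by simpa using h1, h2, rfl⟩
    · rintro ⟨φ, h1, h2, rfl⟩
      exact ⟨StrongDual.toWeakDual φ, ⟨by simpa using h1, h2⟩, rfl⟩
  have hTne : T.Nonempty := by
    obtain ⟨g, hg1, hg2⟩ := exists_dual_vector'' ℂ (1 + a)
    refine ⟨fun x => g x, (hTmem _).2 ⟨g, hg1, ?_, rfl⟩⟩
    rw [hg2, aux_norm_one_add a ha]; rfl
  obtain ⟨f, hf⟩ := hTcomp.extremePoints_nonempty hTne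
  rw [mem_extremePoints] at hf
  obtain ⟨hfT, hfe⟩ := hf
  obtain ⟨φ, hφn, hφ1, rfl⟩ := (hTmem f).1 hfT
  have b1 := hle φ hφn 1
  rw [CStarRing.norm_one] at b1
  have b2 := hle φ hφn a
  have b3 : (φ 1).re + (φ a).re = 1 + ‖a‖ := by
    have := congrArg Complex.re hφ1
    rwa [map_add, Complex.add_re, Complex.ofReal_re] at this
  have b4 := Complex.re_le_norm (φ 1)
  have b5 := Complex.re_le_norm (φ a)
  refine ⟨φ, hφn, ?_, hmax _ _ b2 (by linarith), ?_⟩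
  · simpa using hmax _ _ b1 (by linarith)
  intro ψ₁ ψ₂ h1 h2 t ht0 ht1 hsum
  have c1 := hle ψ₁ h1 (1 + a)
  have c2 := hle ψ₂ h2 (1 + a)
  rw [aux_norm_one_add a ha] at c1 c2
  have c3 := Complex.re_le_norm (ψ₁ (1 + a))
  have c4 := Complex.re_le_norm (ψ₂ (1 + a))
  have c5 : 1 + ‖a‖ = t * (ψ₁ (1 + a)).re + (1 - t) * (ψ₂ (1 + a)).re := by
    have := congrArg Complex.re ((hφ1).symm.trans (hsum (1 + a)))
    rwa [Complex.add_re, Complex.re_ofReal_mul, Complex.re_ofReal_mul, Complex.ofReal_re] at this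
  have m1 : (fun x => ψ₁ x) ∈ T := (hTmem _).2 ⟨ψ₁, h1, hmax _ _ c1 (by nlinarith), rfl⟩
  have m2 : (fun x => ψ₂ x) ∈ T := (hTmem _).2 ⟨ψ₂, h2, hmax _ _ c2 (by nlinarith), rfl⟩
  have := (hfe _ m1 _ m2 ⟨t, 1 - t, ht0, by linarith, by ring, by
    funext x
    rw [hsum x]
    simp [Complex.real_smul]⟩).1
  ext x
  exact congrFun this x

open scoped ComplexOrder in
theorem aux_unital {B : Type} [CStarAlgebra B] [Nontrivial B] (d : B) :
    ∃ (H : Type) (_ : NormedAddCommGroup H) (_ : InnerProductSpace ℂ H) (_ : CompleteSpace H)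
      (ρ : B →⋆ₐ[ℂ] (H →L[ℂ] H)), ‖ρ d‖ = ‖d‖ ∧
      ∀ K : Submodule ℂ H, IsClosed (K : Set H) → (∀ x, ∀ v ∈ K, ρ x v ∈ K) → K = ⊥ ∨ K = ⊤ := by
  let _ := CStarAlgebra.spectralOrder B
  have _ := CStarAlgebra.spectralOrderedRing B
  obtain ⟨φ, hn, h1, ha, hpure⟩ := aux_pure (star d * d) (star_mul_self_nonneg d)
  let f : B →ₚ[ℂ] ℂ := PositiveLinearMap.mk₀ (φ : B →ₗ[ℂ] ℂ) (fun x hx => by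
    have := aux_pos φ hn h1 x hx
    exact Complex.nonneg_iff.2 ⟨this.1, this.2.symm⟩)
  have hf : ∀ x, f x = φ x := fun x => rfl
  let ξ : f.GNS := ((f.toPreGNS 1 : f.PreGNS) : f.GNS)
  have hρξ : ∀ x, f.gnsStarAlgHom x ξ = ((f.toPreGNS x : f.PreGNS) : f.GNS) := by
    intro x
    have := f.gnsNonUnitalStarAlgHom_apply_coe (a := x) (b := f.toPreGNS 1)
    rw [f.leftMulMapPreGNS_apply, f.ofPreGNS_toPreGNS, mul_one] at this
    exact this
  have hnorm : ∀ x, ‖f.gnsStarAlgHom x ξ‖ ^ 2 = (φ (star x * x)).re := by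
    intro x
    rw [hρξ, UniformSpace.Completion.norm_coe]
    have := congrArg Complex.re (f.preGNS_norm_sq (f.toPreGNS x))
    rw [f.ofPreGNS_toPreGNS, hf, ← Complex.ofReal_pow, Complex.ofReal_re] at this
    exact this
  have hξ : ‖ξ‖ = 1 := by
    have := hnorm 1
    rw [map_one, star_one, one_mul, h1, ContinuousLinearMap.one_apply, Complex.one_re] at this
    nlinarith [norm_nonneg ξ]
  refine ⟨f.GNS, inferInstance, inferInstance, inferInstance, f.gnsStarAlgHom, ?_, ?_⟩
  · apply le_antisymm
    · exact NonUnitalStarAlgHom.norm_apply_le f.gnsStarAlgHom d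
    · have e1 := hnorm d
      rw [ha, Complex.ofReal_re, CStarRing.norm_star_mul_self] at e1
      have e2 := (f.gnsStarAlgHom d).le_opNorm ξ
      rw [hξ, mul_one] at e2
      refine le_trans ?_ e2
      nlinarith [norm_nonneg (f.gnsStarAlgHom d ξ), norm_nonneg d]
  · apply aux_irred f.gnsStarAlgHom ξ hξ ?_ φ ?_ hpure
    · have : (fun x => f.gnsStarAlgHom x ξ) =
          (fun y : f.PreGNS => (y : f.GNS)) ∘ (fun x => f.toPreGNS x) := by
        funext x; exact hρξ x
      rw [this]
      exact UniformSpace.Completion.denseRange_coe.comp f.toPreGNS.surjective.denseRange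
        (UniformSpace.Completion.continuous_coe _)
    · intro x
      rw [hρξ, UniformSpace.Completion.inner_coe, f.preGNS_inner_def, f.ofPreGNS_toPreGNS,
        f.ofPreGNS_toPreGNS, star_one, one_mul, hf]

theorem aux_exists_irrRep {A : Type} [NonUnitalCStarAlgebra A] (d : A) (hd : d ≠ 0) :
    ∃ r : IrrRep A, letI := r.nacg; letI := r.ips; ‖r.ρ d‖ = ‖d‖ := by
  obtain ⟨H, _, _, _, ρ, hρ, hirr⟩ := aux_unital (d : Unitization ℂ A)
  rw [Unitization.norm_inr] at hρ
  let σ : A →⋆ₙₐ[ℂ] (H →L[ℂ] H) :=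
    (ρ : Unitization ℂ A →⋆ₙₐ[ℂ] (H →L[ℂ] H)).comp (Unitization.inrNonUnitalStarAlgHom ℂ A)
  have hσ : ∀ a : A, σ a = ρ (a : Unitization ℂ A) := fun a => rfl
  refine ⟨⟨H, σ, ?_, ?_⟩, ?_⟩
  · by_contra! h
    have : σ d = 0 := by ext v; exact h d v
    rw [hσ] at this
    rw [this, norm_zero] at hρ
    exact hd (norm_eq_zero.1 hρ.symm)
  · intro K hK hinv
    apply hirr K hK
    intro x v hv
    induction x using Unitization.ind with
    | inl_add_inr c a =>
      rw [map_add, add_apply]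
      refine K.add_mem ?_ (hinv a v hv)
      have : (Unitization.inl c : Unitization ℂ A) = algebraMap ℂ _ c := rfl
      rw [this, AlgHomClass.commutes, Algebra.algebraMap_eq_smul_one]
      exact K.smul_mem c hv
  · exact hρ

theorem aux_breve_eq {A : Type} [NonUnitalCStarAlgebra A] (d : A) (x : PrimSpace A)
    (r : IrrRep A) (hx : x.1 = r.ker) :
    let _ := r.nacg; letI := r.ips; breve d x = ‖r.ρ d‖ := by
  let _ := r.nacg
  let _ := r.ips
  have _ := r.cpl
  show breve d x = ‖r.ρ d‖
  have hbdd : BddBelow {s : ℝ | ∃ j ∈ x.1, s = ‖d + j‖} :=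
    ⟨0, by rintro _ ⟨j, _, rfl⟩; exact norm_nonneg _⟩
  have h0 : (0 : A) ∈ x.1 := by rw [hx]; exact map_zero r.ρ
  apply le_antisymm
  · apply le_of_forall_pos_le_add
    intro ε hε
    obtain ⟨j, hj, hjn⟩ := aux_lift r.ρ d (‖r.ρ d‖ + ε) (by positivity) (by linarith)
    exact (csInf_le hbdd ⟨j, by rw [hx]; exact hj, rfl⟩).trans hjn
  · refine le_csInf (s := {s : ℝ | ∃ j ∈ x.1, s = ‖d + j‖}) ⟨‖d + 0‖, 0, h0, rfl⟩ ?_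
    rintro _ ⟨j, hj, rfl⟩
    rw [hx] at hj
    have hj' : r.ρ j = 0 := hj
    have := aux_map_norm r.ρ (d + j)
    rwa [map_add, hj', add_zero] at this

theorem aux_main {A : Type} [NonUnitalCStarAlgebra A] [Nontrivial A] (d : A) :
    LowerSemicontinuous (fun x : PrimSpace A => breve d x) ∧
    (∀ x : PrimSpace A, breve d x ≤ ‖d‖) ∧
    (∃ x : PrimSpace A, breve d x = ‖d‖) := by
  refine ⟨?_, ?_, ?_⟩
  · rw [lowerSemicontinuous_iff_isOpen_preimage]
    intro α
    rcases lt_or_ge α 0 with hα | hα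
    · have : (fun x : PrimSpace A => breve d x) ⁻¹' Set.Ioi α = Set.univ := by
        apply Set.eq_univ_of_forall
        intro x
        obtain ⟨r, hr⟩ := x.2
        let _ := r.nacg
        let _ := r.ips
        show α < breve d x
        rw [aux_breve_eq d x r hr]
        exact hα.trans_le (norm_nonneg _)
      rw [this]; exact isOpen_univ
    · apply TopologicalSpace.isOpen_generateFrom_of_mem
      refine ⟨{cfcₙ (fun t : ℝ => max (t - α ^ 2) 0) (star d * d)}, ?_⟩
      ext x
      obtain ⟨r, hr⟩ := x.2
      let _ := r.nacg
      let _ := r.ips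
      have _ := r.cpl
      show α < breve d x ↔ ¬ _ ⊆ x.1
      rw [aux_breve_eq d x r hr, Set.singleton_subset_iff, hr, ← not_le]
      exact not_congr (aux_thresh r.ρ d α hα).symm
  · intro x
    obtain ⟨r, hr⟩ := x.2
    let _ := r.nacg
    let _ := r.ips
    have _ := r.cpl
    rw [aux_breve_eq d x r hr]
    exact aux_map_norm r.ρ d
  · by_cases hd : d = 0
    · obtain ⟨e, he⟩ := exists_ne (0 : A)
      obtain ⟨r, _⟩ := aux_exists_irrRep e he
      refine ⟨⟨r.ker, r, rfl⟩, (aux_breve_eq d ⟨r.ker, r, rfl⟩ r rfl).trans ?_⟩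
      rw [hd, map_zero, norm_zero, norm_zero]
    · obtain ⟨r, hr⟩ := aux_exists_irrRep d hd
      exact ⟨⟨r.ker, r, rfl⟩, (aux_breve_eq d ⟨r.ker, r, rfl⟩ r rfl).trans hr⟩

/-- `d̆` is lower semicontinuous on `Prim A` with the Jacobson topology,
bounded above by `‖d‖`, and attains its supremum `‖d‖` at some point of `Prim A`. -/
theorem breve_lowerSemicontinuous_and_attains_norm
    {A : Type} [NonUnitalCStarAlgebra A] [NormedSpace ℂ A] [IsScalarTower ℂ A A]
    [SMulCommClass ℂ A A] [StarModule ℂ A] [Nontrivial A] (d : A) :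
    LowerSemicontinuous (fun x : PrimSpace A => breve d x) ∧
    (∀ x : PrimSpace A, breve d x ≤ ‖d‖) ∧
    (∃ x : PrimSpace A, breve d x = ‖d‖) := by
  exact @aux_main A
    { (inferInstance : NonUnitalNormedRing A), (inferInstance : StarRing A),
      (inferInstance : CompleteSpace A), (inferInstance : CStarRing A),
      (inferInstance : NormedSpace ℂ A), (inferInstance : IsScalarTower ℂ A A),
      (inferInstance : SMulCommClass ℂ A A), (inferInstance : StarModule ℂ A) with } _ d
end
end

section
/- Let (π, u, H) be a covariant representation of a partial dynamical system (A, G, α) with π faithful, ν an irreducible representation of the generated C*-algebra on H_ν, and π′ an irreducible subrepresentation of ν|_A on H_{π′} with projection P_{π′}. Suppose x′ = ker π′ ∈ Prim A is such that for g ≠ e in a finite set F, either x′ ∉ supp D_g, or x′ ∉ supp D_{g⁻¹}, or x′ ∈ supp D_g ∩ supp D_{g⁻¹} and t_g(x′) ≠ x′. Then for every d₂ ∈ D_g with g ∈ F, g ≠ e, one has P_{π′} ν(π(d₂) u_g) P_{π′} = 0; consequently P_{π′} ν(Σ_{g∈F} π(a(g)) u_g) P_{π′} = P_{π′} π′(a(e))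 P_{π′}. -/
noncomputable section

variable {A : Type} [NonUnitalNormedRing A] [StarRing A] [NormedSpace ℂ A]
  [IsScalarTower ℂ A A] [SMulCommClass ℂ A A] [StarModule ℂ A]

/-- The partial homeomorphism `t_g` of `Prim A` induced by a partial action, as a relation:
`tRel θ g x y` iff `D_{g⁻¹} ⊄ x`, `D_g ⊄ y`, and for all `j ∈ D_g`, `j ∈ y ↔ α_g⁻¹(j) ∈ x`
(this encodes `t_g (ker σ) = ker (σ ∘ α_g⁻¹)`). -/
def tRel {G : Type} [Group G] {A : Type} [NonUnitalNormedRing A] [StarRing A]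
    [NormedSpace ℂ A] [IsScalarTower ℂ A A] [SMulCommClass ℂ A A] [StarModule ℂ A]
    (θ : PartialAction G A) (g : G) (x y : Set A) : Prop :=
  ¬ (θ.D g⁻¹ : Set A) ⊆ x ∧ ¬ (θ.D g : Set A) ⊆ y ∧
  ∀ (j : A) (hj : j ∈ θ.D g), (j ∈ y ↔ (((θ.α g).symm ⟨j, hj⟩ : A) ∈ x))

open ContinuousLinearMap in
/-- A covariant representation `(π, u, H)` of a partial dynamical system `(A, G, α)`:
`π` is a *-representation of `A` on the Hilbert space `H` and each `u g` is a partial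
isometry with initial space `[π(D_{g⁻¹})H]` and final space `[π(D_g)H]`, satisfying
`u_g π(d) u_{g⁻¹} = π(α_g(d))`, `π(d)(u_g u_h - u_{gh}) = 0` and `u_g* = u_{g⁻¹}`. -/
structure CovariantRep {G : Type} [Group G] {A : Type} [NonUnitalNormedRing A]
    [StarRing A] [NormedSpace ℂ A] [IsScalarTower ℂ A A] [SMulCommClass ℂ A A]
    [StarModule ℂ A] (θ : PartialAction G A)
    (H : Type) [NormedAddCommGroup H] [InnerProductSpace ℂ H] [CompleteSpace H] where
  π : A →⋆ₙₐ[ℂ] (H →L[ℂ] H)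
  u : G → (H →L[ℂ] H)
  u_adj : ∀ g : G, adjoint (u g) = u g⁻¹
  partialIsometry : ∀ g : G, u g ∘L (u g⁻¹ ∘L u g) = u g
  initial : ∀ (g : G) (ξ : H), (u g⁻¹ ∘L u g) ξ = ξ ↔
    ξ ∈ closure (Submodule.span ℂ {v : H | ∃ d ∈ θ.D g⁻¹, ∃ w : H, v = π d w} : Set H)
  final : ∀ (g : G) (ξ : H), (u g ∘L u g⁻¹) ξ = ξ ↔
    ξ ∈ closure (Submodule.span ℂ {v : H | ∃ d ∈ θ.D g, ∃ w : H, v = π d w} : Set H)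
  covar : ∀ (g : G) (d : ↥(θ.D g⁻¹)),
    u g ∘L (π (d : A) ∘L u g⁻¹) = π ((θ.α g d : A))
  covar2 : ∀ (g h : G) (d : A), d ∈ θ.D g → d ∈ θ.D (g * h) →
    π d ∘L (u g ∘L u h - u (g * h)) = 0

/-- The C*-algebra generated by the image of a covariant representation `(π, u, H)`
(i.e. by `(π × u)(L)` together with the partial isometries `u_g`). -/
def CovariantRep.genAlg {G : Type} [Group G] {A : Type} [NonUnitalNormedRing A]
    [StarRing A] [NormedSpace ℂ A] [IsScalarTower ℂ A A] [SMulCommClass ℂ A A]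
    [StarModule ℂ A] {θ : PartialAction G A}
    {H : Type} [NormedAddCommGroup H] [InnerProductSpace ℂ H] [CompleteSpace H]
    (ρ : CovariantRep θ H) : StarSubalgebra ℂ (H →L[ℂ] H) :=
  (StarAlgebra.adjoin ℂ (Set.range (fun a : A => ρ.π a) ∪ Set.range ρ.u)).topologicalClosure

variable {G : Type} [Group G] {A : Type} [NonUnitalNormedRing A]
  [StarRing A] [NormedSpace ℂ A] [IsScalarTower ℂ A A] [SMulCommClass ℂ A A]
  [StarModule ℂ A] {θ : PartialAction G A}
  {H : Type} [NormedAddCommGroup H] [InnerProductSpace ℂ H] [CompleteSpace H]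

lemma CovariantRep.pi_mem_genAlg (ρ : CovariantRep θ H) (a : A) : ρ.π a ∈ ρ.genAlg :=
  (StarSubalgebra.le_topologicalClosure _)
    (StarAlgebra.subset_adjoin ℂ _ (Or.inl ⟨a, rfl⟩))

lemma CovariantRep.u_mem_genAlg (ρ : CovariantRep θ H) (g : G) : ρ.u g ∈ ρ.genAlg :=
  (StarSubalgebra.le_topologicalClosure _)
    (StarAlgebra.subset_adjoin ℂ _ (Or.inr ⟨g, rfl⟩))

lemma key_dense {B : Type} [Mul B] {K : Type} [NormedAddCommGroup K] [InnerProductSpace ℂ K]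
    (φ : B → (K →L[ℂ] K)) (hφ : ∀ a b, φ (a * b) = φ a * φ b)
    (H' : Submodule ℂ K) (hc : IsClosed (H' : Set K))
    (hinv : ∀ a : B, ∀ v ∈ H', φ a v ∈ H')
    (hirr : ∀ K' : Submodule ℂ K, IsClosed (K' : Set K) → K' ≤ H' →
      (∀ a : B, ∀ v ∈ K', φ a v ∈ K') → K' = ⊥ ∨ K' = H')
    (T : K →L[ℂ] K) (hT : ∀ v, T v ∈ H') (D : Set B) (hD : ∀ a, ∀ d ∈ D, a * d ∈ D)
    (d₂ : B) (hd₂ : d₂ ∈ D) (hne : φ d₂ * T ≠ 0) (j : B)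
    (hj : ∀ d ∈ D, φ j * (φ d * T) = 0) : ∀ ξ ∈ H', φ j ξ = 0 := by
  set W := Submodule.span ℂ {v : K | ∃ d ∈ D, ∃ w : K, v = φ d (T w)} with hW
  have hWH : W.topologicalClosure ≤ H' := by
    apply Submodule.topologicalClosure_minimal _ _ hc
    rw [hW, Submodule.span_le]
    rintro _ ⟨d, hd, w, rfl⟩
    exact hinv _ _ (hT w)
  have hWinv : ∀ a : B, ∀ v ∈ W.topologicalClosure, φ a v ∈ W.topologicalClosure := by
    intro a
    have : W.topologicalClosure ≤ W.topologicalClosure.comap (φ a : K →ₗ[ℂ] K) := by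
      apply Submodule.topologicalClosure_minimal
      · conv_lhs => rw [hW]
        rw [Submodule.span_le]
        rintro _ ⟨d, hd, w, rfl⟩
        apply W.le_topologicalClosure
        apply Submodule.subset_span
        exact ⟨a * d, hD a d hd, w, by rw [hφ]; rfl⟩
      · exact W.isClosed_topologicalClosure.preimage (φ a).continuous
    exact fun v hv => this hv
  have hker : W.topologicalClosure ≤ LinearMap.ker (φ j : K →ₗ[ℂ] K) := by
    apply Submodule.topologicalClosure_minimal
    · rw [hW, Submodule.span_le]
      rintro _ ⟨d, hd, w, rfl⟩
      have := congrArg (fun f : K →L[ℂ] K => f w) (hj d hd)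
      simpa using this
    · exact (φ j).isClosed_ker
  rcases hirr _ W.isClosed_topologicalClosure hWH hWinv with h | h
  · exfalso
    apply hne
    ext w
    have : φ d₂ (T w) ∈ W.topologicalClosure :=
      W.le_topologicalClosure (Submodule.subset_span ⟨d₂, hd₂, w, rfl⟩)
    rw [h] at this
    simpa using this
  · intro ξ hξ
    rw [← h] at hξ
    exact hker hξ

lemma CovariantRep.pi_mul_uu (ρ : CovariantRep θ H) (g : G) (c : A) (hc : c ∈ θ.D g⁻¹) :
    ρ.π c * (ρ.u g⁻¹ * ρ.u g) = ρ.π c := by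
  have h1 : (ρ.u g⁻¹ * ρ.u g) * ρ.π (star c) = ρ.π (star c) := by
    ext w
    exact (ρ.initial g _).2 (subset_closure (Submodule.subset_span ⟨star c, star_mem hc, w, rfl⟩))
  have h2 := congrArg star h1
  have e1 : star (ρ.u g) = ρ.u g⁻¹ := ρ.u_adj g
  have e2 : star (ρ.u g⁻¹) = ρ.u g := by rw [← e1, star_star]
  rw [star_mul, star_mul, map_star, star_star, e1, e2] at h2
  exact h2

lemma CovariantRep.pi_u (ρ : CovariantRep θ H) (g : G) (c : ↥(θ.D g⁻¹)) :
    ρ.π (θ.α g c : A) * ρ.u g = ρ.u g * ρ.π (c : A) := by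
  have h : ρ.u g * (ρ.π (c : A) * ρ.u g⁻¹) = ρ.π (θ.α g c : A) := ρ.covar g c
  rw [← h, mul_assoc, mul_assoc, ρ.pi_mul_uu g c c.2]

lemma CovariantRep.pi_u_one (ρ : CovariantRep θ H) (d : A) : ρ.π d * ρ.u 1 = ρ.π d := by
  have hd : ∀ g : G, g = 1 → d ∈ θ.D g := by
    rintro _ rfl
    rw [θ.D_one]; trivial
  have h1 : ρ.π d * (ρ.u 1 * ρ.u 1 - ρ.u (1 * 1)) = 0 :=
    ρ.covar2 1 1 d (hd _ rfl) (hd _ (by simp))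
  have h2 := ρ.pi_mul_uu 1 d (hd _ (by simp))
  rw [inv_one] at h2
  rw [mul_sub, h2, mul_one, sub_eq_zero] at h1
  exact h1.symm

/-- Lemma 2.6 (ii): with `π′` an irreducible subrepresentation of `ν|_A`
on `H_{π′}` (projection `P₁`) whose kernel `x′ ∈ Prim A` satisfies, for each `g ≠ e` in a
finite set `F`: `x′ ∉ supp D_g`, or `x′ ∉ supp D_{g⁻¹}`, or `t_g(x′) ≠ x′`; then
`P₁ ν(π(d₂) u_g) P₁ = 0` for `d₂ ∈ D_g`, `g ∈ F`, `g ≠ e`, and consequently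
`P₁ ν(Σ_{g∈F} π(a(g)) u_g) P₁ = P₁ π′(a(e)) P₁`. -/
theorem compression_kills_nontrivial_components
    {G : Type} [Group G] {A : Type} [NonUnitalCStarAlgebra A] [NormedSpace ℂ A]
    [IsScalarTower ℂ A A] [SMulCommClass ℂ A A] [StarModule ℂ A]
    {θ : PartialAction G A}
    {H : Type} [NormedAddCommGroup H] [InnerProductSpace ℂ H] [CompleteSpace H]
    (ρ : CovariantRep θ H) (hfaith : Function.Injective ρ.π)
    {K : Type} [NormedAddCommGroup K] [InnerProductSpace ℂ K] [CompleteSpace K]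
    (ν : ↥ρ.genAlg →⋆ₐ[ℂ] (K →L[ℂ] K))
    (hνirr : ∀ K' : Submodule ℂ K, IsClosed (K' : Set K) →
      (∀ c : ↥ρ.genAlg, ∀ v ∈ K', ν c v ∈ K') → K' = ⊥ ∨ K' = ⊤)
    (H' : Submodule ℂ K) (hH'closed : IsClosed (H' : Set K))
    (hH'inv : ∀ a : A, ∀ v ∈ H', ν ⟨ρ.π a, ρ.pi_mem_genAlg a⟩ v ∈ H')
    (hH'irr : ∀ K' : Submodule ℂ K, IsClosed (K' : Set K) → K' ≤ H' →
      (∀ a : A, ∀ v ∈ K', ν ⟨ρ.π a, ρ.pi_mem_genAlg a⟩ v ∈ K') → K' = ⊥ ∨ K' = H')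
    (P₁ : K →L[ℂ] K) (hP₁idem : IsIdempotentElem P₁)
    (hP₁sa : ContinuousLinearMap.adjoint P₁ = P₁)
    (hP₁range : ∀ ξ : K, P₁ ξ = ξ ↔ ξ ∈ H')
    -- the kernel `x′ = ker π′` of the subrepresentation:
    (x' : Set A) (hx' : x' = {a : A | ∀ ξ ∈ H', ν ⟨ρ.π a, ρ.pi_mem_genAlg a⟩ ξ = 0})
    (F : Finset G)
    -- position of `x′` relative to the sets `supp D_g`, `supp D_{g⁻¹}` and `t_g`:
    (hpos : ∀ g ∈ F, g ≠ 1 →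
      (θ.D g : Set A) ⊆ x' ∨ (θ.D g⁻¹ : Set A) ⊆ x' ∨
      (¬ (θ.D g : Set A) ⊆ x' ∧ ¬ (θ.D g⁻¹ : Set A) ⊆ x' ∧
        ∀ y : Set A, tRel θ g x' y → y ≠ x')) :
    (∀ g ∈ F, g ≠ 1 → ∀ d₂ ∈ θ.D g,
      P₁ * ν ⟨ρ.π d₂ * ρ.u g, mul_mem (ρ.pi_mem_genAlg d₂) (ρ.u_mem_genAlg g)⟩ * P₁ = 0) ∧
    (∀ (a : G → A), (∀ g, a g ∈ θ.D g) → (∀ g ∉ F, a g = 0) →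
      ∀ hmem : (∑ g ∈ F, ρ.π (a g) * ρ.u g) ∈ ρ.genAlg,
        P₁ * ν ⟨∑ g ∈ F, ρ.π (a g) * ρ.u g, hmem⟩ * P₁
          = P₁ * ν ⟨ρ.π (a 1), ρ.pi_mem_genAlg (a 1)⟩ * P₁) := by
  classical
  subst hx'
  obtain ⟨φ, hφ⟩ : ∃ φ : A → (K →L[ℂ] K), ∀ a, φ a = ν ⟨ρ.π a, ρ.pi_mem_genAlg a⟩ :=
    ⟨_, fun _ => rfl⟩
  obtain ⟨U, hU⟩ : ∃ U : G → (K →L[ℂ] K), ∀ g, U g = ν ⟨ρ.u g, ρ.u_mem_genAlg g⟩ :=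
    ⟨_, fun _ => rfl⟩
  simp only [← hφ] at hH'inv hH'irr hpos ⊢
  have hmul : ∀ a b, φ (a * b) = φ a * φ b := by
    intro a b
    rw [hφ, hφ, hφ, ← map_mul]
    congr 1
    exact Subtype.ext (map_mul ρ.π a b)
  have hstar : ∀ a, φ (star a) = star (φ a) := by
    intro a
    rw [hφ, hφ, ← map_star]
    congr 1
    exact Subtype.ext (map_star ρ.π a)
  have hprod : ∀ d g, ν ⟨ρ.π d * ρ.u g, mul_mem (ρ.pi_mem_genAlg d) (ρ.u_mem_genAlg g)⟩
      = φ d * U g := by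
    intro d g
    rw [hφ, hU, ← map_mul]
    rfl
  have hPs : star P₁ = P₁ := hP₁sa
  have hPmem : ∀ v, P₁ v ∈ H' := fun v => by
    rw [← hP₁range]
    exact congrArg (fun f : K →L[ℂ] K => f v) hP₁idem
  have hPφP : ∀ a, P₁ * (φ a * P₁) = φ a * P₁ := by
    intro a
    ext v
    exact (hP₁range _).2 (hH'inv a _ (hPmem v))
  have hcomm : ∀ a, P₁ * φ a = φ a * P₁ := by
    intro a
    have h := congrArg star (hPφP (star a))
    simp only [star_mul, hPs, hstar, star_star] at h
    rw [← h, mul_assoc, hPφP]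
  have hcov : ∀ g (c : ↥(θ.D g⁻¹)), φ (θ.α g c : A) * U g = U g * φ (c : A) := by
    intro g c
    rw [hφ, hφ, hU, ← map_mul, ← map_mul]
    congr 1
    exact Subtype.ext (ρ.pi_u g c)
  have hkill : ∀ a, (∀ ξ ∈ H', φ a ξ = 0) → φ a * P₁ = 0 := by
    intro a ha
    ext v
    exact ha _ (hPmem v)
  have main : ∀ g ∈ F, g ≠ 1 → ∀ d₂ ∈ θ.D g, P₁ * (φ d₂ * U g) * P₁ = 0 := by
    intro g hg hg1 d₂ hd₂
    rcases hpos g hg hg1 with h | h | ⟨hn1, hn2, h⟩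
    · rw [← mul_assoc, hcomm, hkill d₂ (h hd₂), zero_mul, zero_mul]
    · obtain ⟨c, hc⟩ := (θ.α g).surjective ⟨d₂, hd₂⟩
      have hc' : (θ.α g c : A) = d₂ := congrArg Subtype.val hc
      rw [← hc', hcov, mul_assoc, mul_assoc, hkill (c : A) (h c.2), mul_zero, mul_zero]
    · by_contra hne
      apply h _ _ rfl
      refine ⟨hn2, hn1, ?_⟩
      obtain ⟨T, hTdef⟩ : ∃ T, T = P₁ * (U g * P₁) := ⟨_, rfl⟩
      have htw : ∀ c : ↥(θ.D g⁻¹), φ (θ.α g c : A) * T = T * φ (c : A) := by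
        intro c
        rw [hTdef, ← mul_assoc, ← hcomm, mul_assoc, ← mul_assoc (φ _), hcov]
        simp only [mul_assoc]
        rw [hcomm]
      have htw' : ∀ c : ↥(θ.D g⁻¹), φ (c : A) * star T = star T * φ (θ.α g c : A) := by
        intro c
        have h1 := congrArg star (htw (star c))
        rw [star_mul, star_mul, ← hstar, ← hstar, map_star] at h1
        simpa using h1.symm
      have hTm : ∀ v, T v ∈ H' := fun v => by rw [hTdef]; exact hPmem _
      have hTm' : ∀ v, star T v ∈ H' := fun v => by
        rw [hTdef, star_mul, star_mul, hPs, mul_assoc]; exact hPmem _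
      have hTP : T * P₁ = T := by
        rw [hTdef, mul_assoc, mul_assoc, hP₁idem.eq]
      have hTP' : star T * P₁ = star T := by
        rw [hTdef, star_mul, star_mul, hPs, mul_assoc, hP₁idem.eq]
      have hne1 : φ d₂ * T ≠ 0 := by
        intro h0
        apply hne
        rw [← h0, hTdef, ← mul_assoc, ← mul_assoc, ← mul_assoc, hcomm]
      have killT : ∀ S : K →L[ℂ] K, S * P₁ = S → ∀ a, (∀ ξ ∈ H', φ a ξ = 0) → S * φ a = 0 := by
        intro S hS a ha
        rw [← hS, mul_assoc, hcomm, hkill a ha, mul_zero]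
      intro j hj
      obtain ⟨c, hc⟩ := (θ.α g).surjective ⟨j, hj⟩
      have hc' : (θ.α g c : A) = j := congrArg Subtype.val hc
      have hcs : (θ.α g).symm ⟨j, hj⟩ = c := by
        rw [← hc]; exact (θ.α g).symm_apply_apply c
      rw [hcs]
      constructor
      · intro hjx
        obtain ⟨c₂, hc₂⟩ := (θ.α g).surjective ⟨star d₂, star_mem hd₂⟩
        have hc₂' : (θ.α g c₂ : A) = star d₂ := congrArg Subtype.val hc₂
        refine key_dense φ hmul H' hH'closed hH'inv hH'irr (star T) hTm' (θ.D g⁻¹ : Set A)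
          (fun a d hd => θ.idealL _ a d hd) c₂ c₂.2 ?_ c ?_
        · rw [htw', hc₂', hstar, ← star_mul]
          exact fun h0 => hne1 (star_eq_zero.1 h0)
        · intro e he
          rw [htw' ⟨e, he⟩, ← mul_assoc, htw', hc', killT _ hTP' j hjx, zero_mul]
      · intro hcx
        refine key_dense φ hmul H' hH'closed hH'inv hH'irr T hTm (θ.D g : Set A)
          (fun a d hd => θ.idealL _ a d hd) d₂ hd₂ hne1 j ?_
        intro e he
        obtain ⟨e', he'⟩ := (θ.α g).surjective ⟨e, he⟩
        have he2 : (θ.α g e' : A) = e := congrArg Subtype.val he'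
        rw [← he2, htw, ← mul_assoc, ← hc', htw, killT _ hTP _ hcx, zero_mul]
  refine ⟨?_, ?_⟩
  · intro g hg hg1 d₂ hd₂
    rw [hprod]
    exact main g hg hg1 d₂ hd₂
  · intro a ha haF hmem
    have hsum : ν ⟨∑ g ∈ F, ρ.π (a g) * ρ.u g, hmem⟩ = ∑ g ∈ F, φ (a g) * U g := by
      simp only [← hprod]
      rw [← map_sum]
      congr 1
      apply Subtype.ext
      simp
    have hone : φ (a 1) * U 1 = φ (a 1) := by
      rw [← hprod, hφ]
      congr 1
      exact Subtype.ext (ρ.pi_u_one (a 1))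
    rw [hsum, Finset.mul_sum, Finset.sum_mul]
    rw [Finset.sum_eq_single (1 : G)]
    · rw [hone]
    · intro g hg hg1
      exact main g hg hg1 _ (ha g)
    · intro h1
      have : φ (a 1) = 0 := by
        rw [haF 1 h1, hφ]
        rw [← map_zero ν]
        congr 1
        exact Subtype.ext (map_zero ρ.π)
      rw [this]; simp
end
end

section
/- Let α be a partial action of a discrete group G on a C*-algebra A and let t_g : supp D_{g⁻¹} → supp D_g be defined on primitive ideals by t_g(ker σ) = ker(σ ∘ α_g⁻¹) for irreducible representations σ with σ(D_{g⁻¹}) ≠ 0. Then each t_g is a well-defined homeomorphism between open subsets of Prim A (with the Jacobson topology), and {t_g}_{g∈G} is a partial action of G on Prim A by partial homeomorphisms: t_e = id, t_{g⁻¹} = t_g⁻¹, and t_{gh} extends t_g ∘ t_h. -/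
noncomputable section

variable {A : Type} [NonUnitalNormedRing A] [StarRing A] [NormedSpace ℂ A]
  [IsScalarTower ℂ A A] [SMulCommClass ℂ A A] [StarModule ℂ A]

theorem cyc_dense {J : Type} [NonUnitalNormedRing J] [StarRing J] [NormedSpace ℂ J]
    {H : Type} [NormedAddCommGroup H] [InnerProductSpace ℂ H] [CompleteSpace H]
    (π : J →⋆ₙₐ[ℂ] (H →L[ℂ] H))
    (hnz : ∃ a v, π a v ≠ 0)
    (irr : ∀ K : Submodule ℂ H, IsClosed (K : Set H) →
      (∀ a : J, ∀ v ∈ K, π a v ∈ K) → K = ⊥ ∨ K = ⊤) (v : H) (hv : v ≠ 0)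
    (e : J →ₗ[ℂ] H) (he : ∀ j, e j = π j v) : DenseRange e := by
  have hinv : ∀ a : J, ∀ w ∈ (LinearMap.range e).topologicalClosure,
      π a w ∈ (LinearMap.range e).topologicalClosure := by
    intro a w hw
    have : (LinearMap.range e).topologicalClosure ≤
        (LinearMap.range e).topologicalClosure.comap (π a).toLinearMap := by
      apply Submodule.topologicalClosure_minimal
      · rintro _ ⟨j, rfl⟩
        apply Submodule.le_topologicalClosure
        refine ⟨a * j, ?_⟩
        simp [he, map_mul]
      · exact (Submodule.isClosed_topologicalClosure _).preimage (π a).continuous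
    exact this hw
  rcases irr _ (Submodule.isClosed_topologicalClosure _) hinv with h | h
  · exfalso
    have h0 : ∀ j, π j v = 0 := by
      intro j
      have : e j ∈ (LinearMap.range e).topologicalClosure :=
        Submodule.le_topologicalClosure _ ⟨j, rfl⟩
      rw [h, Submodule.mem_bot, he] at this
      exact this
    let N : Submodule ℂ H := ⨅ j : J, LinearMap.ker (π j).toLinearMap
    have memN : ∀ w, w ∈ N ↔ ∀ j, π j w = 0 := by
      intro w; simp [N, Submodule.mem_iInf]
    have hNc : IsClosed (N : Set H) := by
      have : (N : Set H) = ⋂ j : J, {w | π j w = 0} := by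
        ext w; simp [memN]
      rw [this]
      exact isClosed_iInter fun j => isClosed_eq (π j).continuous continuous_const
    have hNi : ∀ a : J, ∀ w ∈ N, π a w ∈ N := by
      intro a w hw
      rw [memN] at hw ⊢
      intro j
      rw [hw a, map_zero]
    rcases irr N hNc hNi with h | h
    · have : v ∈ N := (memN v).2 h0
      rw [h, Submodule.mem_bot] at this
      exact hv this
    · obtain ⟨a, w, haw⟩ := hnz
      have : w ∈ N := by rw [h]; trivial
      exact haw ((memN w).1 this a)
  · rw [DenseRange, ← LinearMap.coe_range]
    exact (Submodule.dense_iff_topologicalClosure_eq_top).2 h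

theorem restrict_irr (r : IrrRep A) (D : NonUnitalStarSubalgebra ℂ A)
    (hL : ∀ a : A, ∀ d ∈ D, a * d ∈ D) (hR : ∀ a : A, ∀ d ∈ D, d * a ∈ D)
    (hD : ¬ (D : Set A) ⊆ r.ker) (K : @Submodule ℂ r.H _ r.nacg.toAddCommGroup.toAddCommMonoid
      (r.ips.toNormedSpace.toModule)) (hK : @IsClosed r.H r.nacg.toUniformSpace.toTopologicalSpace (K : Set r.H))
    (hinv : ∀ d ∈ D, ∀ v ∈ K, r.ρ d v ∈ K) : K = ⊥ ∨ K = ⊤ := by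
  obtain ⟨H, ρ, nonzero, irr⟩ := r
  simp only at *
  rw [or_iff_not_imp_left]
  intro hne
  obtain ⟨v, hvK, hv⟩ := Submodule.exists_mem_ne_zero_of_ne_bot hne
  let L0 : Submodule ℂ H := Submodule.span ℂ {w | ∃ d ∈ D, w = ρ d v}
  have hLi : ∀ a : A, ∀ w ∈ L0.topologicalClosure, ρ a w ∈ L0.topologicalClosure := by
    intro a w hw
    have : L0.topologicalClosure ≤ L0.topologicalClosure.comap (ρ a).toLinearMap := by
      apply Submodule.topologicalClosure_minimal
      · apply Submodule.span_le.2
        rintro _ ⟨d, hd, rfl⟩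
        apply Submodule.le_topologicalClosure
        apply Submodule.subset_span
        exact ⟨a * d, hL a d hd, by simp [map_mul]⟩
      · exact (Submodule.isClosed_topologicalClosure _).preimage (ρ a).continuous
    exact this hw
  rcases irr _ (Submodule.isClosed_topologicalClosure _) hLi with h | h
  · exfalso
    have h0 : ∀ d ∈ D, ρ d v = 0 := by
      intro d hd
      have : ρ d v ∈ L0.topologicalClosure :=
        Submodule.le_topologicalClosure _ (Submodule.subset_span ⟨d, hd, rfl⟩)
      rw [h, Submodule.mem_bot] at this
      exact this
    let N : Submodule ℂ H := ⨅ j : D, LinearMap.ker (ρ j).toLinearMap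
    have memN : ∀ w, w ∈ N ↔ ∀ j ∈ D, ρ j w = 0 := by
      intro w; simp [N, Submodule.mem_iInf]
    have hNc : IsClosed (N : Set H) := by
      have : (N : Set H) = ⋂ j : D, {w | ρ j w = 0} := by
        ext w; simp [memN]
      rw [this]
      exact isClosed_iInter fun j => isClosed_eq (ρ j).continuous continuous_const
    have hNi : ∀ a : A, ∀ w ∈ N, ρ a w ∈ N := by
      intro a w hw
      rw [memN] at hw ⊢
      intro j hj
      have := hw (j * a) (hR a j hj)
      simpa [map_mul] using this
    rcases irr N hNc hNi with h | h
    · have : v ∈ N := (memN v).2 h0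
      rw [h, Submodule.mem_bot] at this
      exact hv this
    · apply hD
      intro d hd
      change ρ d = 0
      ext w
      have : w ∈ N := by rw [h]; trivial
      simpa using (memN w).1 this d hd
  · rw [eq_top_iff, ← h]
    apply Submodule.topologicalClosure_minimal _ _ hK
    apply Submodule.span_le.2
    rintro _ ⟨d, hd, rfl⟩
    exact hinv d hd v hvK

/-- Membership in a primitive ideal is detected by an ideal not contained in it. -/
theorem mem_prim_iff {x : Set A} (hx : x ∈ PrimSet A) (I : Set A)
    (hL : ∀ a : A, ∀ d ∈ I, a * d ∈ I) (hI : ¬ I ⊆ x) (a : A) :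
    a ∈ x ↔ ∀ d ∈ I, a * d ∈ x := by
  obtain ⟨⟨H, ρ, nonzero, irr⟩, rfl⟩ := hx
  simp only [IrrRep.ker, Set.mem_ofPred_eq] at *
  constructor
  · intro h d _
    rw [map_mul, h, zero_mul]
  intro h
  let L0 : Submodule ℂ H := Submodule.span ℂ {w | ∃ d ∈ I, ∃ v, w = ρ d v}
  have hLi : ∀ a : A, ∀ w ∈ L0.topologicalClosure, ρ a w ∈ L0.topologicalClosure := by
    intro a w hw
    have : L0.topologicalClosure ≤ L0.topologicalClosure.comap (ρ a).toLinearMap := by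
      apply Submodule.topologicalClosure_minimal
      · apply Submodule.span_le.2
        rintro _ ⟨d, hd, v, rfl⟩
        apply Submodule.le_topologicalClosure
        apply Submodule.subset_span
        exact ⟨a * d, hL a d hd, v, by simp [map_mul]⟩
      · exact (Submodule.isClosed_topologicalClosure _).preimage (ρ a).continuous
    exact this hw
  rcases irr _ (Submodule.isClosed_topologicalClosure _) hLi with h' | h'
  · exfalso
    apply hI
    intro d hd
    change ρ d = 0
    ext v
    have : ρ d v ∈ L0.topologicalClosure :=
      Submodule.le_topologicalClosure _ (Submodule.subset_span ⟨d, hd, v, rfl⟩)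
    rw [h', Submodule.mem_bot] at this
    simpa using this
  · have : L0.topologicalClosure ≤ LinearMap.ker (ρ a).toLinearMap := by
      apply Submodule.topologicalClosure_minimal
      · apply Submodule.span_le.2
        rintro _ ⟨d, hd, v, rfl⟩
        have := h d hd
        rw [map_mul] at this
        exact congrArg (fun T : H →L[ℂ] H => T v) this
      · exact isClosed_eq (ρ a).continuous continuous_const
    ext v
    have hv : v ∈ L0.topologicalClosure := by rw [h']; trivial
    simpa using this hv

theorem prim_ne_univ {x : Set A} (hx : x ∈ PrimSet A) : ∃ a, a ∉ x := by
  obtain ⟨⟨H, ρ, ⟨a, v, h⟩, irr⟩, rfl⟩ := hx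
  refine ⟨a, fun h' => h ?_⟩
  change ρ a = 0 at h'
  rw [h']; rfl

theorem ext_bound [CompleteSpace A] [CStarRing A] (D : NonUnitalStarSubalgebra ℂ A)
    (hc : IsClosed (D : Set A)) (hL : ∀ a : A, ∀ d ∈ D, a * d ∈ D)
    {H : Type} [NormedAddCommGroup H] [InnerProductSpace ℂ H] [CompleteSpace H]
    (π : D →⋆ₙₐ[ℂ] (H →L[ℂ] H)) (v : H) (a : A) (j : D) :
    ‖π ⟨a * j, hL a j j.2⟩ v‖ ≤ ‖a‖ * ‖π j v‖ := by
  let : NonUnitalCStarAlgebra A := {}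
  have := hc
  let : NonUnitalCStarAlgebra D := NonUnitalStarSubalgebra.nonUnitalCStarAlgebra D
  let := CStarAlgebra.spectralOrder D
  let := CStarAlgebra.spectralOrderedRing D
  have hu := CStarAlgebra.increasingApproximateUnit D
  have hcont : Continuous π := map_continuous π
  have hm : Continuous fun d : D => (⟨a * d, hL a d d.2⟩ : D) :=
    Continuous.subtype_mk (continuous_const.mul continuous_subtype_val) _
  have ht : Filter.Tendsto (fun u : D => π ⟨a * (u * j : D), hL a _ (u * j).2⟩ v)
      (CStarAlgebra.approximateUnit D) (nhds (π ⟨a * j, hL a j j.2⟩ v)) := by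
    have h1 := hu.tendsto_mul_right j
    have h2 : Continuous fun d : D => π ⟨a * d, hL a d d.2⟩ v :=
      (hcont.comp hm).clm_apply continuous_const
    exact (h2.tendsto j).comp h1
  refine le_of_tendsto ht.norm ?_
  filter_upwards [hu.eventually_norm] with u hun
  have : (⟨a * (u * j : D), hL a _ (u * j).2⟩ : D) = ⟨a * u, hL a u u.2⟩ * j := by
    ext; simp [mul_assoc]
  rw [this, map_mul]
  calc ‖(π ⟨a * u, hL a u u.2⟩ * π j) v‖ = ‖π ⟨a * u, hL a u u.2⟩ (π j v)‖ := rfl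
    _ ≤ ‖π ⟨a * u, hL a u u.2⟩‖ * ‖π j v‖ := ContinuousLinearMap.le_opNorm _ _
    _ ≤ ‖a‖ * ‖π j v‖ := by
      gcongr
      refine (NonUnitalStarAlgHom.norm_apply_le π _).trans ?_
      change ‖a * (u : A)‖ ≤ _
      refine (norm_mul_le _ _).trans ?_
      have : ‖(u : A)‖ ≤ 1 := hun
      nlinarith [norm_nonneg a]

theorem ext_rep [CompleteSpace A] [CStarRing A] (D : NonUnitalStarSubalgebra ℂ A)
    (hc : IsClosed (D : Set A)) (hL : ∀ a : A, ∀ d ∈ D, a * d ∈ D)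
    {H : Type} [NormedAddCommGroup H] [InnerProductSpace ℂ H] [CompleteSpace H]
    (π : D →⋆ₙₐ[ℂ] (H →L[ℂ] H))
    (hnz : ∃ a v, π a v ≠ 0)
    (irr : ∀ K : Submodule ℂ H, IsClosed (K : Set H) →
      (∀ a : D, ∀ v ∈ K, π a v ∈ K) → K = ⊥ ∨ K = ⊤) :
    ∃ r : IrrRep A, ∀ j (hj : j ∈ D), j ∈ r.ker ↔ π ⟨j, hj⟩ = 0 := by
  obtain ⟨a0, v, hv⟩ := id hnz
  have hv0 : v ≠ 0 := by rintro rfl; simp at hv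
  let e : D →ₗ[ℂ] H :=
    { toFun := fun j => π j v
      map_add' := by intro x y; simp
      map_smul' := by intro c x; simp }
  have hd : DenseRange e := cyc_dense π hnz irr v hv0 e (fun _ => rfl)
  let f : A → (D →ₗ[ℂ] H) := fun a =>
    { toFun := fun j => π ⟨a * j, hL a j j.2⟩ v
      map_add' := by
        intro x y
        have : (⟨a * (x + y : D), hL a _ (x + y).2⟩ : D) =
            ⟨a * x, hL a x x.2⟩ + ⟨a * y, hL a y y.2⟩ := by ext; simp [mul_add]
        rw [this, map_add]; rfl
      map_smul' := by
        intro c x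
        have : (⟨a * (c • x : D), hL a _ (c • x).2⟩ : D) =
            c • ⟨a * x, hL a x x.2⟩ := Subtype.ext (mul_smul_comm c a (x : A))
        rw [this, map_smul]; rfl }
  let P : A → (H →L[ℂ] H) := fun a => (f a).extendOfNorm e
  have hP : ∀ a (j : D), P a (π j v) = π ⟨a * j, hL a j j.2⟩ v := fun a j =>
    LinearMap.extendOfNorm_eq (f := f a) hd ⟨‖a‖, fun j => ext_bound D hc hL π v a j⟩ j
  have hext : ∀ S T : H →L[ℂ] H, (∀ j : D, S (π j v) = T (π j v)) → S = T := by
    intro S T h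
    apply ContinuousLinearMap.coeFn_injective
    exact hd.equalizer S.continuous T.continuous (funext h)
  have hPD : ∀ j (hj : j ∈ D), P j = π ⟨j, hj⟩ := by
    intro j hj
    apply hext
    intro k
    rw [hP]
    have : (⟨j * k, hL j k k.2⟩ : D) = ⟨j, hj⟩ * k := rfl
    rw [this, map_mul]; rfl
  have hmul : ∀ a b, P (a * b) = P a * P b := by
    intro a b
    apply hext
    intro k
    rw [mul_apply_eq_comp, hP, hP, hP]
    congr 3
    exact mul_assoc _ _ _
  have hstar : ∀ a, P (star a) = star (P a) := by
    intro a
    rw [ContinuousLinearMap.star_eq_adjoint, ContinuousLinearMap.eq_adjoint_iff]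
    have key : ∀ j k : D, inner ℂ (P (star a) (π j v)) (π k v) =
        inner ℂ (π j v) (P a (π k v)) := by
      intro j k
      rw [hP, hP, ← ContinuousLinearMap.adjoint_inner_right, ← ContinuousLinearMap.adjoint_inner_right (π j),
        ← ContinuousLinearMap.star_eq_adjoint, ← ContinuousLinearMap.star_eq_adjoint, ← map_star, ← map_star,
        ← mul_apply_eq_comp, ← mul_apply_eq_comp, ← map_mul, ← map_mul]
      congr 3
      ext
      simp [mul_assoc]
    have key2 : ∀ (j : D) (y : H), inner ℂ (P (star a) (π j v)) y =
        inner ℂ (π j v) (P a y) := by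
      intro j y
      have : (fun y => inner ℂ (P (star a) (π j v)) y) = fun y => inner ℂ (π j v) (P a y) :=
        hd.equalizer (by fun_prop) (by fun_prop) (funext (key j))
      exact congrFun this y
    intro x y
    have : (fun x => inner ℂ (P (star a) x) y) = fun x => inner ℂ x (P a y) :=
        hd.equalizer (by fun_prop) (by fun_prop) (funext fun j => key2 j y)
    exact congrFun this x
  have hadd : ∀ a b, P (a + b) = P a + P b := by
    intro a b
    apply hext
    intro k
    rw [add_apply, hP, hP, hP, ← add_apply, ← map_add]
    congr 3
    exact add_mul _ _ _
  have hsmul : ∀ (c : ℂ) a, P (c • a) = c • P a := by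
    intro c a
    apply hext
    intro k
    rw [smul_apply, hP, hP, ← smul_apply, ← map_smul]
    congr 3
    exact smul_mul_assoc _ _ _
  have hzero : P 0 = 0 := by simpa using hsmul 0 0
  let ρ : A →⋆ₙₐ[ℂ] (H →L[ℂ] H) :=
    { toFun := P, map_smul' := hsmul, map_zero' := hzero, map_add' := hadd,
      map_mul' := hmul, map_star' := hstar }
  refine ⟨⟨H, ρ, ?_, ?_⟩, ?_⟩
  · refine ⟨a0, v, ?_⟩
    change P a0 v ≠ 0
    rw [hPD a0 a0.2]; exact hv
  · intro K hK hi
    refine irr K hK fun a w hw => ?_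
    have := hi a w hw
    change P a w ∈ K at this
    rwa [hPD a a.2] at this
  · intro j hj
    change P j = 0 ↔ _
    rw [hPD j hj]

section PA

variable {G : Type} [Group G] (θ : PartialAction G A)

theorem alpha_of_eq_one (k : G) (hk : k = 1) (d : θ.D k⁻¹) : (θ.α k d : A) = d := by
  subst hk
  exact θ.α_one d

theorem mem_D_of_eq_one (k : G) (hk : k = 1) (a : A) : a ∈ θ.D k := by
  subst hk
  rw [θ.D_one]; trivial

theorem alpha_inv_alpha (g : G) (d : θ.D g⁻¹) (h : (θ.α g d : A) ∈ θ.D g⁻¹⁻¹) :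
    (θ.α g⁻¹ ⟨θ.α g d, h⟩ : A) = d := by
  have hd : (d : A) ∈ θ.D (g⁻¹ * g)⁻¹ := mem_D_of_eq_one θ _ (by simp) _
  rw [← θ.comp g⁻¹ g d hd h]
  exact alpha_of_eq_one θ _ (by simp) _

theorem symm_mem (g k : G) (j : A) (hj : j ∈ θ.D g) (hk : j ∈ θ.D k) :
    ((θ.α g).symm ⟨j, hj⟩ : A) ∈ θ.D (g⁻¹ * k) := by
  have hj' : j ∈ θ.D g⁻¹⁻¹ := by rwa [inv_inv]
  have h1 := θ.mapsInto g⁻¹ k ⟨j, hj'⟩ hk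
  have h2 := alpha_inv_alpha θ g ((θ.α g).symm ⟨j, hj⟩) (by simpa using hj)
  simp only [StarAlgEquiv.apply_symm_apply] at h2
  rw [← h2]
  exact h1

theorem tRel_inv {g : G} {x y : Set A} (h : tRel θ g x y) : tRel θ g⁻¹ y x := by
  obtain ⟨h1, h2, h3⟩ := h
  refine ⟨by rwa [inv_inv], h1, fun j hj => ?_⟩
  have hm : (θ.α g ⟨j, hj⟩ : A) ∈ θ.D g⁻¹⁻¹ := by rw [inv_inv]; exact (θ.α g ⟨j, hj⟩).2
  have h4 := alpha_inv_alpha θ g ⟨j, hj⟩ hm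
  have h5 : (θ.α g⁻¹).symm ⟨j, hj⟩ = ⟨θ.α g ⟨j, hj⟩, hm⟩ := by
    rw [StarAlgEquiv.symm_apply_eq]
    exact Subtype.ext h4.symm
  rw [h5]
  have h6 := h3 (θ.α g ⟨j, hj⟩) (θ.α g ⟨j, hj⟩).2
  simp only [Subtype.coe_eta, StarAlgEquiv.symm_apply_apply] at h6
  exact h6.symm

theorem tRel_unique {g : G} {x y y' : Set A} (hy : y ∈ PrimSet A) (hy' : y' ∈ PrimSet A)
    (h : tRel θ g x y) (h' : tRel θ g x y') : y = y' := by
  ext a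
  rw [mem_prim_iff hy (θ.D g) (θ.idealL g) h.2.1, mem_prim_iff hy' (θ.D g) (θ.idealL g) h'.2.1]
  refine forall₂_congr fun d hd => ?_
  rw [h.2.2 _ (θ.idealL g a d hd), h'.2.2 _ (θ.idealL g a d hd)]

theorem tRel_exists [CompleteSpace A] [CStarRing A] {g : G} {x : Set A} (hx : x ∈ PrimSet A)
    (h : ¬ (θ.D g⁻¹ : Set A) ⊆ x) : ∃ y ∈ PrimSet A, tRel θ g x y := by
  obtain ⟨r, rfl⟩ := hx
  have hirr := restrict_irr r (θ.D g⁻¹) (θ.idealL _) (θ.idealR _) h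
  obtain ⟨H, ρ, nonzero, irr⟩ := r
  let π : θ.D g →⋆ₙₐ[ℂ] (H →L[ℂ] H) :=
    { toFun := fun j => ρ ((θ.α g).symm j : A)
      map_smul' := by intro c a; simp
      map_zero' := by simp
      map_add' := by intro a b; simp
      map_mul' := by intro a b; simp
      map_star' := by intro a; simp [map_star] }
  have hπ : ∀ j, π j = ρ ((θ.α g).symm j : A) := fun _ => rfl
  obtain ⟨d, hd, hdx⟩ := Set.not_subset.1 h
  have hdd : π (θ.α g ⟨d, hd⟩) = ρ d := by rw [hπ]; simp
  have hdx' : ρ d ≠ 0 := hdx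
  obtain ⟨r, hr⟩ := ext_rep (θ.D g) (θ.closed g) (θ.idealL g) π (by
      refine ⟨θ.α g ⟨d, hd⟩, ?_⟩
      rw [hdd]
      by_contra! hcon
      exact hdx' (by ext v; simpa using hcon v)) (by
      intro K hK hi
      refine hirr K hK fun d hd v hv => ?_
      have := hi (θ.α g ⟨d, hd⟩) v hv
      rw [hπ] at this
      simpa using this)
  refine ⟨r.ker, ⟨r, rfl⟩, h, ?_, ?_⟩
  · intro hs
    have := (hr _ (θ.α g ⟨d, hd⟩).2).1 (hs (θ.α g ⟨d, hd⟩).2)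
    exact hdx' (hdd ▸ this)
  · intro j hj
    exact hr j hj

theorem tRel_comp {g h : G} {x y z : Set A} (hx : x ∈ PrimSet A) (hy : y ∈ PrimSet A)
    (hz : z ∈ PrimSet A) (h1 : tRel θ h x y) (h2 : tRel θ g y z) : tRel θ (g * h) x z := by
  -- an element of `D h ∩ D g⁻¹` outside `y`
  obtain ⟨a, ha, hay⟩ := Set.not_subset.1 h1.2.1
  rw [mem_prim_iff hy (θ.D g⁻¹) (θ.idealL _) h2.1] at hay
  push Not at hay
  obtain ⟨b, hb, hab⟩ := hay
  have hm1 : a * b ∈ θ.D h := θ.idealR _ _ _ ha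
  have hm2 : a * b ∈ θ.D g⁻¹ := θ.idealL _ _ _ hb
  generalize a * b = c at hab hm1 hm2
  -- push it to `x` and to `z`
  have hx1 : ((θ.α h).symm ⟨c, hm1⟩ : A) ∉ x := fun hc => hab ((h1.2.2 c hm1).2 hc)
  have hx2 : ((θ.α h).symm ⟨c, hm1⟩ : A) ∈ θ.D (g * h)⁻¹ := by
    rw [mul_inv_rev]; exact symm_mem θ h g⁻¹ c hm1 hm2
  have hx3 : ((θ.α h).symm ⟨c, hm1⟩ : A) ∈ θ.D h⁻¹ := ((θ.α h).symm ⟨c, hm1⟩).2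
  have hz1 : (θ.α g ⟨c, hm2⟩ : A) ∉ z := by
    intro hc
    have := (h2.2.2 _ (θ.α g ⟨c, hm2⟩).2).1 hc
    simp only [Subtype.coe_eta, StarAlgEquiv.symm_apply_apply] at this
    exact hab this
  have hz2 : (θ.α g ⟨c, hm2⟩ : A) ∈ θ.D (g * h) := θ.mapsInto g h ⟨c, hm2⟩ hm1
  have hz3 : (θ.α g ⟨c, hm2⟩ : A) ∈ θ.D g := (θ.α g ⟨c, hm2⟩).2
  -- the special case
  have special : ∀ (j : A) (hj : j ∈ θ.D (g * h)), j ∈ θ.D g →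
      (j ∈ z ↔ ((θ.α (g * h)).symm ⟨j, hj⟩ : A) ∈ x) := by
    intro j hj hjg
    have e1 : ((θ.α g).symm ⟨j, hjg⟩ : A) ∈ θ.D h := by
      have := symm_mem θ g (g * h) j hjg hj
      rwa [inv_mul_cancel_left] at this
    rw [h2.2.2 j hjg, h1.2.2 _ e1]
    have e2 : ((θ.α h).symm ⟨_, e1⟩ : A) ∈ θ.D (g * h)⁻¹ := by
      rw [mul_inv_rev]; exact symm_mem θ h g⁻¹ _ e1 ((θ.α g).symm ⟨j, hjg⟩).2
    have e3 := θ.comp g h ((θ.α h).symm ⟨_, e1⟩) e2 (by simp)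
    simp only [StarAlgEquiv.apply_symm_apply, Subtype.coe_eta] at e3
    have e4 : (θ.α (g * h)).symm ⟨j, hj⟩ = ⟨_, e2⟩ := by
      rw [StarAlgEquiv.symm_apply_eq]
      exact Subtype.ext e3.symm
    rw [e4]
  refine ⟨fun hs => hx1 (hs hx2), fun hs => hz1 (hs hz2), fun j hj => ?_⟩
  rw [mem_prim_iff hz {d | d ∈ θ.D (g * h) ∧ d ∈ θ.D g}
      (fun a d hd => ⟨θ.idealL _ a d hd.1, θ.idealL _ a d hd.2⟩)
      (fun hs => hz1 (hs ⟨hz2, hz3⟩)),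
    mem_prim_iff hx {d | d ∈ θ.D (g * h)⁻¹ ∧ d ∈ θ.D h⁻¹}
      (fun a d hd => ⟨θ.idealL _ a d hd.1, θ.idealL _ a d hd.2⟩)
      (fun hs => hx1 (hs ⟨hx2, hx3⟩))]
  constructor
  · rintro H d ⟨hd1, hd2⟩
    have m1 : (θ.α (g * h) ⟨d, hd1⟩ : A) ∈ θ.D (g * h) := (θ.α (g * h) ⟨d, hd1⟩).2
    have m2 : (θ.α (g * h) ⟨d, hd1⟩ : A) ∈ θ.D g := by
      have := θ.mapsInto (g * h) h⁻¹ ⟨d, hd1⟩ hd2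
      rwa [mul_inv_cancel_right] at this
    have := (special _ (θ.idealL _ j _ m1) (θ.idealL _ j _ m2)).1 (H _ ⟨m1, m2⟩)
    have e : (⟨j * θ.α (g * h) ⟨d, hd1⟩, θ.idealL _ j _ m1⟩ : θ.D (g * h)) =
      ⟨j, hj⟩ * θ.α (g * h) ⟨d, hd1⟩ := rfl
    rw [e, map_mul, StarAlgEquiv.symm_apply_apply] at this
    exact this
  · rintro H d ⟨hd1, hd2⟩
    rw [special _ (θ.idealL _ j _ hd1) (θ.idealL _ j _ hd2)]
    have e : (⟨j * d, θ.idealL _ j _ hd1⟩ : θ.D (g * h)) = ⟨j, hj⟩ * ⟨d, hd1⟩ := rfl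
    rw [e, map_mul]
    refine H _ ⟨((θ.α (g * h)).symm ⟨d, hd1⟩).2, ?_⟩
    have := symm_mem θ (g * h) g d hd1 hd2
    have hk : (g * h)⁻¹ * g = h⁻¹ := by group
    rwa [hk] at this

theorem tRel_continuous {g : G}
    (T : ↥(suppIdeal (θ.D g⁻¹ : Set A)) → ↥(suppIdeal (θ.D g : Set A)))
    (hT : ∀ x, tRel θ g x.1.1 (T x).1.1) : Continuous T := by
  refine Continuous.subtype_mk (f := fun x => (T x).1) ?_ _
  refine continuous_generateFrom_iff.2 ?_
  rintro _ ⟨J, rfl⟩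
  have : (fun x => (T x).1) ⁻¹' {x : PrimSpace A | ¬ J ⊆ x.1} =
      Subtype.val ⁻¹' {x : PrimSpace A | ¬ {b | ∃ a ∈ J, ∃ d, ∃ hd : d ∈ θ.D g,
        b = ((θ.α g).symm ⟨a * d, θ.idealL g a d hd⟩ : A)} ⊆ x.1} := by
    ext x
    change (¬ J ⊆ (T x).1.1) ↔ ¬ _ ⊆ x.1.1
    rw [not_iff_not]
    constructor
    · rintro hs _ ⟨a, ha, d, hd, rfl⟩
      rw [← (hT x).2.2]
      exact (mem_prim_iff (T x).1.2 (θ.D g) (θ.idealL g) (hT x).2.1 a).1 (hs ha) d hd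
    · intro hs a ha
      rw [mem_prim_iff (T x).1.2 (θ.D g) (θ.idealL g) (hT x).2.1 a]
      intro d hd
      rw [(hT x).2.2 _ (θ.idealL g a d hd)]
      exact hs ⟨a, ha, d, hd, rfl⟩
  rw [this]
  refine IsOpen.preimage continuous_subtype_val ?_
  exact TopologicalSpace.isOpen_generateFrom_of_mem ⟨_, rfl⟩

theorem tRel_homeo [CompleteSpace A] [CStarRing A] (g : G) :
    ∃ T : ↥(suppIdeal (θ.D g⁻¹ : Set A)) ≃ₜ ↥(suppIdeal (θ.D g : Set A)),
      ∀ x, tRel θ g x.1.1 ((T x).1.1) := by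
  have hex : ∀ x : ↥(suppIdeal (θ.D g⁻¹ : Set A)), ∃ y : ↥(suppIdeal (θ.D g : Set A)),
      tRel θ g x.1.1 y.1.1 := by
    intro x
    obtain ⟨y, hy, h⟩ := tRel_exists θ x.1.2 x.2
    exact ⟨⟨⟨y, hy⟩, h.2.1⟩, h⟩
  have hex' : ∀ y : ↥(suppIdeal (θ.D g : Set A)), ∃ x : ↥(suppIdeal (θ.D g⁻¹ : Set A)),
      tRel θ g⁻¹ y.1.1 x.1.1 := by
    intro y
    obtain ⟨x, hx, h⟩ := tRel_exists θ (g := g⁻¹) y.1.2 (by rw [inv_inv]; exact y.2)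
    exact ⟨⟨⟨x, hx⟩, h.2.1⟩, h⟩
  choose T hT using hex
  choose S hS using hex'
  have hS' : ∀ y, tRel θ g (S y).1.1 y.1.1 := by
    intro y
    have := tRel_inv θ (hS y)
    rwa [inv_inv] at this
  have hScont : Continuous S := by
    have hc : ∀ k : G, k = g → ∀ S' : ↥(suppIdeal (θ.D k : Set A)) →
        ↥(suppIdeal (θ.D g⁻¹ : Set A)), (k = g⁻¹⁻¹) →
        (∀ y, tRel θ g⁻¹ y.1.1 (S' y).1.1) → Continuous S' := by
      rintro k - S' rfl hS'
      exact tRel_continuous θ S' hS'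
    exact hc g rfl S (inv_inv g).symm hS
  refine ⟨⟨⟨T, S, ?_, ?_⟩, tRel_continuous θ T hT, hScont⟩, hT⟩
  · intro x
    apply Subtype.ext
    apply Subtype.ext
    exact tRel_unique θ (S (T x)).1.2 x.1.2 (hS (T x)) (tRel_inv θ (hT x))
  · intro y
    apply Subtype.ext
    apply Subtype.ext
    exact tRel_unique θ (T (S y)).1.2 y.1.2 (hT (S y)) (hS' y)

end PA

/-- the maps `t_g (ker σ) = ker (σ ∘ α_g⁻¹)` are well-defined homeomorphisms
between the open sets `supp D_{g⁻¹}` and `supp D_g` of `Prim A`, and `{t_g}` is a partial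
action of `G` on `Prim A` by partial homeomorphisms: `t_e = id`, `t_{g⁻¹} = t_g⁻¹`, and
`t_{gh}` extends `t_g ∘ t_h`. -/
theorem tRel_partialAction_on_prim
    {G : Type} [Group G] {A : Type} [NonUnitalCStarAlgebra A] [NormedSpace ℂ A]
    [IsScalarTower ℂ A A] [SMulCommClass ℂ A A] [StarModule ℂ A]
    (θ : PartialAction G A) :
    (∀ g : G, IsOpen (suppIdeal (θ.D g : Set A))) ∧
    (∀ (g : G) (x : PrimSpace A), x ∈ suppIdeal (θ.D g⁻¹ : Set A) →
      ∃! y : PrimSpace A, tRel θ g x.1 y.1) ∧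
    (∀ g : G, ∃ T : ↥(suppIdeal (θ.D g⁻¹ : Set A)) ≃ₜ ↥(suppIdeal (θ.D g : Set A)),
      ∀ x, tRel θ g x.1.1 ((T x).1.1)) ∧
    (∀ x : PrimSpace A, tRel θ 1 x.1 x.1) ∧
    (∀ (g : G) (x y : Set A), x ∈ PrimSet A → y ∈ PrimSet A →
      (tRel θ g x y ↔ tRel θ g⁻¹ y x)) ∧
    (∀ (g h : G) (x y z : Set A), x ∈ PrimSet A → y ∈ PrimSet A → z ∈ PrimSet A →
      tRel θ h x y → tRel θ g y z → tRel θ (g * h) x z) := by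

  refine ⟨fun g => TopologicalSpace.isOpen_generateFrom_of_mem ⟨_, rfl⟩, ?_,
    fun g => tRel_homeo θ g, ?_, ?_, ?_⟩
  · intro g x hx
    obtain ⟨y, hy, h⟩ := tRel_exists θ x.2 hx
    refine ⟨⟨y, hy⟩, h, fun y' h' => ?_⟩
    exact Subtype.ext (tRel_unique θ y'.2 hy h' h)
  · intro x
    obtain ⟨a, ha⟩ := prim_ne_univ x.2
    refine ⟨fun hs => ha (hs (mem_D_of_eq_one θ _ (by simp) a)),
      fun hs => ha (hs (mem_D_of_eq_one θ _ rfl a)), fun j hj => ?_⟩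
    have h := θ.α_one ((θ.α 1).symm ⟨j, hj⟩)
    rw [StarAlgEquiv.apply_symm_apply] at h
    rw [← h]
  · intro g x y _ _
    refine ⟨tRel_inv θ, fun h => ?_⟩
    have := tRel_inv θ h
    rwa [inv_inv] at this
  · intro g h x y z hx hy hz h1 h2
    exact tRel_comp θ hx hy hz h1 h2
end
end
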